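/- arXiv:2210.10559 — 6 statements merged into one kernel-verified Lean document; each statement's English description precedes it below -/
import Mathlib

section
/- The kernel of ψ₁ equals the ideal of R₁ generated by the 2×2 minors of the matrix M₁. -/
open MvPolynomial

/-- The index type for the 20 variables `z_{i,kl}` with `i ∈ {1,2}` and `1 ≤ k ≤ l ≤ 4`. -/
abbrev ZVar : Type := Fin 2 × {p : Fin 4 × Fin 4 // p.1 ≤ p.2}

/-- The polynomial ring `R₁ = ℂ[z_{i,kl}]` in 20 variables. -/
abbrev R1 : Type := MvPolynomial ZVar ℂ

/-- The target polynomial ring `ℂ[t₁,t₂,x₁,x₂,x₃,x₄]`; variables `0,1` are `t₁,t₂`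
and variables `2,3,4,5` are `x₁,x₂,x₃,x₄`. -/
abbrev T6 : Type := MvPolynomial (Fin 6) ℂ

/-- The variable `z_{i,kl}` of `R₁` (for arbitrary `k, l`, using symmetry `z_{i,kl} = z_{i,lk}`). -/
noncomputable def zVar (i : Fin 2) (k l : Fin 4) : R1 :=
  X (i, ⟨(min k l, max k l), min_le_max⟩)

/-- The ℂ-algebra homomorphism `ψ₁ : R₁ → ℂ[t₁,t₂,x₁,…,x₄]`, `z_{i,kl} ↦ tᵢ xₖ xₗ`. -/
noncomputable def psi1 : R1 →ₐ[ℂ] T6 :=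
  aeval fun w : ZVar =>
    X (Fin.castLE (by norm_num) w.1) *
      X (⟨(w.2.1.1 : ℕ) + 2, Nat.add_lt_add_right w.2.1.1.isLt 2⟩ : Fin 6) *
      X (⟨(w.2.1.2 : ℕ) + 2, Nat.add_lt_add_right w.2.1.2.isLt 2⟩ : Fin 6)

/-- The `4 × 8` matrix `M₁ = [A | B]` over `R₁`, where `A`, `B` are the symmetric `4 × 4`
matrices with entries `A_{kl} = z_{1,kl}`, `B_{kl} = z_{2,kl}`. -/
noncomputable def M1 : Matrix (Fin 4) (Fin 8) R1 :=
  fun k c => zVar (if (c : ℕ) < 4 then 0 else 1) k ⟨(c : ℕ) % 4, Nat.mod_lt _ (by norm_num)⟩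

/-- The ideal generated by the `2 × 2` minors of a matrix. -/
def minors2 {R : Type*} [CommRing R] {m n : Type*} (M : Matrix m n R) : Ideal R :=
  Ideal.span {x | ∃ i₁ i₂ j₁ j₂, x = M i₁ j₁ * M i₂ j₂ - M i₁ j₂ * M i₂ j₁}

/-- If an algebra homomorphism of polynomial rings maps monomials to monomials, then its kernel is
contained in every ideal modulo which any two monomials with equal images agree. -/
theorem ker_le_of_monomial_congr {σ τ R : Type*} [CommRing R]
    (φ : MvPolynomial σ R →ₐ[R] MvPolynomial τ R) (I : Ideal (MvPolynomial σ R))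
    (hφ : ∀ e : σ →₀ ℕ, ∃ u : τ →₀ ℕ, φ (monomial e 1) = monomial u 1)
    (hI : ∀ e e' : σ →₀ ℕ, φ (monomial e 1) = φ (monomial e' 1) →
      monomial e 1 - monomial e' 1 ∈ I) :
    RingHom.ker φ.toRingHom ≤ I := by
  classical
  choose f hf using hφ
  let g : (τ →₀ ℕ) → MvPolynomial σ R ⧸ I := fun u =>
    if h : ∃ e, f e = u then Ideal.Quotient.mk I (monomial h.choose 1) else 0
  let s : MvPolynomial τ R →ₗ[R] MvPolynomial σ R ⧸ I := (basisMonomials τ R).constr R g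
  have hs : s ∘ₗ φ.toLinearMap = (Ideal.Quotient.mkₐ R I).toLinearMap := by
    refine (basisMonomials σ R).ext fun e => ?_
    have h : ∃ e', f e' = f e := ⟨e, rfl⟩
    have h1 : s (monomial (f e) 1) = g (f e) := by
      simpa only [coe_basisMonomials] using (basisMonomials τ R).constr_basis R g (f e)
    have h2 : g (f e) = Ideal.Quotient.mk I (monomial h.choose 1) := dif_pos h
    simp only [coe_basisMonomials, LinearMap.comp_apply, AlgHom.toLinearMap_apply, hf, h1, h2,
      Ideal.Quotient.mkₐ_eq_mk]
    refine (Ideal.Quotient.mk_eq_mk_iff_sub_mem _ _).2 (hI _ _ ?_)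
    rw [hf, hf, h.choose_spec]
  intro p hp
  have hp' : φ p = 0 := hp
  have := LinearMap.congr_fun hs p
  simp only [LinearMap.comp_apply, AlgHom.toLinearMap_apply, hp', map_zero,
    Ideal.Quotient.mkₐ_eq_mk] at this
  exact Ideal.Quotient.eq_zero_iff_mem.1 this.symm

/-- The variable `tᵢ` of the target ring. -/
noncomputable def tVar (i : Fin 2) : T6 := X (Fin.castLE (by norm_num) i)

/-- The variable `xₖ` of the target ring. -/
noncomputable def xVar (k : Fin 4) : T6 := X ⟨(k : ℕ) + 2, Nat.add_lt_add_right k.isLt 2⟩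

/-- The monomials of `R₁`. -/
noncomputable def zMonomials : Submonoid R1 := Submonoid.closure {m | ∃ i k l, m = zVar i k l}

theorem zVar_comm (i : Fin 2) (k l : Fin 4) : zVar i k l = zVar i l k := by
  simp only [zVar, min_comm, max_comm]

theorem zVar_mem_zMonomials (i : Fin 2) (k l : Fin 4) : zVar i k l ∈ zMonomials :=
  Submonoid.subset_closure ⟨i, k, l, rfl⟩

theorem psi1_zVar (i : Fin 2) (k l : Fin 4) : psi1 (zVar i k l) = tVar i * xVar k * xVar l := by
  rcases le_total k l with h | h
  · simp [psi1, zVar, tVar, xVar, h]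
  · simp [psi1, zVar, tVar, xVar, h]
    ring

theorem prime_tVar (i : Fin 2) : Prime (tVar i) := X_prime

theorem prime_xVar (k : Fin 4) : Prime (xVar k) := X_prime

theorem tVar_dvd_tVar {i j : Fin 2} : tVar i ∣ tVar j ↔ i = j := by
  rw [tVar, tVar, X_dvd_X]
  simp

theorem xVar_dvd_xVar {k l : Fin 4} : xVar k ∣ xVar l ↔ k = l := by
  rw [xVar, xVar, X_dvd_X]
  simp [Fin.ext_iff]

theorem not_tVar_dvd_xVar (i : Fin 2) (k : Fin 4) : ¬ tVar i ∣ xVar k := by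
  rw [tVar, xVar, X_dvd_X]
  simp [Fin.ext_iff]
  omega

theorem not_xVar_dvd_tVar (k : Fin 4) (i : Fin 2) : ¬ xVar k ∣ tVar i := by
  rw [tVar, xVar, X_dvd_X]
  simp [Fin.ext_iff]
  omega

theorem psi1_monomial (e : ZVar →₀ ℕ) :
    ∃ u : Fin 6 →₀ ℕ, psi1 (monomial e 1) = monomial u 1 := by
  induction e using Finsupp.induction_linear with
  | zero => exact ⟨0, map_one _⟩
  | add e e' he he' =>
    obtain ⟨u, hu⟩ := he
    obtain ⟨u', hu'⟩ := he'
    refine ⟨u + u', ?_⟩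
    rw [← one_mul (1 : ℂ), ← monomial_mul, map_mul, hu, hu', monomial_mul]
  | single w n =>
    rw [← X_pow_eq_monomial, map_pow, psi1, aeval_X]
    simp only [X, monomial_mul, monomial_pow, one_mul, one_pow]
    exact ⟨_, rfl⟩

theorem monomial_mem_zMonomials (e : ZVar →₀ ℕ) : (monomial e 1 : R1) ∈ zMonomials := by
  induction e using Finsupp.induction_linear with
  | zero => exact one_mem _
  | add e e' he he' =>
    rw [← one_mul (1 : ℂ), ← monomial_mul]
    exact mul_mem he he'
  | single w n =>
    rw [← X_pow_eq_monomial]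
    obtain ⟨i, ⟨⟨k, l⟩, h : k ≤ l⟩⟩ := w
    have hX : (X (i, ⟨(k, l), h⟩) : R1) = zVar i k l := by simp [zVar, h]
    rw [hX]
    exact pow_mem (zVar_mem_zMonomials i k l) n

/-- A prime dividing the image of a monomial divides the image of one of its variables. -/
theorem exists_factor_of_dvd {q : T6} (hq : Prime q) {m : R1} (hm : m ∈ zMonomials)
    (h : q ∣ psi1 m) :
    ∃ i k l, q ∣ psi1 (zVar i k l) ∧ ∃ m' ∈ zMonomials, m = zVar i k l * m' := by
  induction hm using Submonoid.closure_induction_left with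
  | one => exact absurd (isUnit_of_dvd_one (by simpa using h)) hq.not_isUnit
  | mul_left w hw m hm ih =>
    obtain ⟨i, k, l, rfl⟩ := hw
    rw [map_mul] at h
    rcases hq.dvd_or_dvd h with h | h
    · exact ⟨i, k, l, h, m, hm, rfl⟩
    · obtain ⟨i', k', l', h', m', hm', rfl⟩ := ih h
      exact ⟨i', k', l', h', zVar i k l * m', mul_mem (zVar_mem_zMonomials i k l) hm', by ring⟩

theorem exists_factor_of_tVar_dvd {i : Fin 2} {m : R1} (hm : m ∈ zMonomials)
    (h : tVar i ∣ psi1 m) : ∃ a b, ∃ m' ∈ zMonomials, m = zVar i a b * m' := by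
  obtain ⟨j, a, b, hd, m', hm', rfl⟩ := exists_factor_of_dvd (prime_tVar i) hm h
  rw [psi1_zVar, (prime_tVar i).dvd_mul, (prime_tVar i).dvd_mul, tVar_dvd_tVar] at hd
  rcases hd with (rfl | hd) | hd
  · exact ⟨a, b, m', hm', rfl⟩
  · exact absurd hd (not_tVar_dvd_xVar _ _)
  · exact absurd hd (not_tVar_dvd_xVar _ _)

theorem exists_factor_of_xVar_dvd {k : Fin 4} {m : R1} (hm : m ∈ zMonomials)
    (h : xVar k ∣ psi1 m) : ∃ j b, ∃ m' ∈ zMonomials, m = zVar j k b * m' := by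
  obtain ⟨j, a, b, hd, m', hm', rfl⟩ := exists_factor_of_dvd (prime_xVar k) hm h
  rw [psi1_zVar, (prime_xVar k).dvd_mul, (prime_xVar k).dvd_mul, xVar_dvd_xVar,
    xVar_dvd_xVar] at hd
  rcases hd with (hd | rfl) | rfl
  · exact absurd hd (not_xVar_dvd_tVar _ _)
  · exact ⟨j, b, m', hm', rfl⟩
  · exact ⟨j, a, m', hm', by rw [zVar_comm]⟩

theorem exists_M1_eq_zVar (i : Fin 2) (a : Fin 4) : ∃ c, ∀ k, M1 k c = zVar i k a := by
  refine ⟨⟨4 * i + a, by omega⟩, fun k => ?_⟩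
  fin_cases i <;> fin_cases a <;> rfl

theorem exists_zVar_eq_M1 (c : Fin 8) : ∃ i a, ∀ k, M1 k c = zVar i k a :=
  ⟨_, _, fun _ => rfl⟩

theorem exchange_mem_minors2 (i j : Fin 2) (k l a b : Fin 4) :
    zVar i k a * zVar j l b - zVar i l a * zVar j k b ∈ minors2 M1 := by
  obtain ⟨c, hc⟩ := exists_M1_eq_zVar i a
  obtain ⟨d, hd⟩ := exists_M1_eq_zVar j b
  refine Ideal.subset_span ⟨k, l, c, d, ?_⟩
  rw [hc, hc, hd, hd]
  ring

theorem minors2_le_ker : minors2 M1 ≤ RingHom.ker psi1.toRingHom := by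
  refine Ideal.span_le.2 ?_
  rintro _ ⟨k, l, c, d, rfl⟩
  obtain ⟨i, a, hc⟩ := exists_zVar_eq_M1 c
  obtain ⟨j, b, hd⟩ := exists_zVar_eq_M1 d
  change psi1 _ = 0
  simp only [hc, hd, map_sub, map_mul, psi1_zVar]
  ring

theorem psi1_eq_of_sub_mem {m m' : R1} (h : m - m' ∈ minors2 M1) : psi1 m = psi1 m' := by
  have : psi1 (m - m') = 0 := minors2_le_ker h
  rwa [map_sub, sub_eq_zero] at this

/-- If `xₖ` divides the image of `z_{i,ab} m` apart from `x_b`, then, modulo the minors, the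
index `a` can be exchanged for `k`. -/
theorem exists_exchange {i : Fin 2} {k a b : Fin 4} {m : R1} (hm : m ∈ zMonomials)
    (h : xVar k ∣ xVar a * psi1 m) :
    ∃ m' ∈ zMonomials, zVar i a b * m - zVar i k b * m' ∈ minors2 M1 := by
  rcases (prime_xVar k).dvd_or_dvd h with h | h
  · obtain rfl := xVar_dvd_xVar.1 h
    exact ⟨m, hm, by simp⟩
  · obtain ⟨j, c, m', hm', rfl⟩ := exists_factor_of_xVar_dvd hm h
    refine ⟨zVar j a c * m', mul_mem (zVar_mem_zMonomials _ _ _) hm', ?_⟩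
    convert Ideal.mul_mem_left _ m' (exchange_mem_minors2 i j a k b c) using 1
    ring

/-- A monomial whose image is divisible by that of `z_{i,kl}` is, modulo the minors, a multiple
of `z_{i,kl}`. -/
theorem exists_factor_mod_minors2 {i : Fin 2} {k l : Fin 4} {m : R1} (hm : m ∈ zMonomials)
    (h : psi1 (zVar i k l) ∣ psi1 m) :
    ∃ m' ∈ zMonomials, m - zVar i k l * m' ∈ minors2 M1 := by
  rw [psi1_zVar] at h
  obtain ⟨a, b, m₁, hm₁, rfl⟩ := exists_factor_of_tVar_dvd hm
    (((dvd_mul_right _ _).mul_right _).trans h)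
  have hab : xVar k * xVar l ∣ xVar a * (xVar b * psi1 m₁) := by
    refine (mul_dvd_mul_iff_left (prime_tVar i).ne_zero).1 ?_
    simpa only [map_mul, psi1_zVar, mul_assoc] using h
  obtain ⟨c, m₂, hm₂, h₂⟩ : ∃ c, ∃ m₂ ∈ zMonomials,
      zVar i a b * m₁ - zVar i k c * m₂ ∈ minors2 M1 := by
    rcases (prime_xVar k).dvd_or_dvd ((dvd_mul_right _ _).trans hab) with hk | hk
    · obtain rfl := xVar_dvd_xVar.1 hk
      exact ⟨b, m₁, hm₁, by simp⟩
    · obtain ⟨m₂, hm₂, h₂⟩ := exists_exchange (i := i) (b := a) hm₁ hk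
      exact ⟨a, m₂, hm₂, by rwa [zVar_comm i a b]⟩
  have hc : xVar l ∣ xVar c * psi1 m₂ := by
    refine (mul_dvd_mul_iff_left (mul_ne_zero (prime_tVar i).ne_zero (prime_xVar k).ne_zero)).1 ?_
    rw [psi1_eq_of_sub_mem h₂, map_mul, psi1_zVar] at h
    simpa only [mul_assoc] using h
  obtain ⟨m₃, hm₃, h₃⟩ := exists_exchange (i := i) (b := k) hm₂ hc
  refine ⟨m₃, hm₃, ?_⟩
  rw [zVar_comm i c k, zVar_comm i l k] at h₃
  simpa using add_mem h₂ h₃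

theorem sub_mem_minors2_of_psi1_eq {m m' : R1} (hm : m ∈ zMonomials) (hm' : m' ∈ zMonomials)
    (h : psi1 m = psi1 m') : m - m' ∈ minors2 M1 := by
  induction hm' using Submonoid.closure_induction_left generalizing m with
  | one =>
    induction hm using Submonoid.closure_induction_left with
    | one => simp
    | mul_left w hw m hm ih =>
      obtain ⟨i, k, l, rfl⟩ := hw
      refine absurd (isUnit_of_dvd_one (a := tVar i) ?_) (prime_tVar i).not_isUnit
      rw [map_one, map_mul, psi1_zVar] at h
      exact ⟨xVar k * xVar l * psi1 m, by rw [← h]; ring⟩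
  | mul_left w hw m' hm' ih =>
    obtain ⟨i, k, l, rfl⟩ := hw
    rw [map_mul] at h
    obtain ⟨m₁, hm₁, h₁⟩ := exists_factor_mod_minors2 (i := i) (k := k) (l := l) hm
      (h ▸ dvd_mul_right _ _)
    have hne : psi1 (zVar i k l) ≠ 0 := by
      rw [psi1_zVar]
      exact mul_ne_zero (mul_ne_zero (prime_tVar i).ne_zero (prime_xVar k).ne_zero)
        (prime_xVar l).ne_zero
    rw [psi1_eq_of_sub_mem h₁, map_mul] at h
    have := Ideal.mul_mem_left _ (zVar i k l) (ih hm₁ (mul_left_cancel₀ hne h))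
    convert add_mem h₁ this using 1
    ring

/-- The kernel of `ψ₁` equals the ideal of `R₁` generated by the
`2 × 2` minors of `M₁`: the image of the half-anticanonical Segre–Veronese embedding
`φ₁ : ℙ¹ × ℙ³ ↪ ℙ¹⁹` is cut out scheme-theoretically by the `2 × 2` minors of `M₁`. -/
theorem ker_psi1_eq_minors : RingHom.ker psi1.toRingHom = minors2 M1 := by
  refine le_antisymm (ker_le_of_monomial_congr psi1 _ psi1_monomial fun e e' h => ?_)
    minors2_le_ker
  exact sub_mem_minors2_of_psi1_eq (monomial_mem_zMonomials e) (monomial_mem_zMonomials e') h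
end

section
/- The ideal of R₁ generated by the 2×2 minors of M₁ is a prime ideal, and the quotient ring R₁ / (2×2 minors of M₁) has Krull dimension 5. -/
open MvPolynomial

section KrullDim

theorem ringKrullDim_eq_of_isIntegral_of_injective {R S : Type*} [CommRing R] [CommRing S]
    [Algebra R S] [Algebra.IsIntegral R S] (hinj : Function.Injective (algebraMap R S)) :
    ringKrullDim S = ringKrullDim R := by
  have : FaithfulSMul R S := (faithfulSMul_iff_algebraMap_injective R S).mpr hinj
  apply le_antisymm
  · refine Order.krullDim_le_of_strictMono (PrimeSpectrum.comap (algebraMap R S)) fun P Q h => ?_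
    exact Ideal.IsIntegral.comap_lt_comap (R := R) (I := P.asIdeal) (J := Q.asIdeal) h
  · refine iSup_le fun l => ?_
    obtain ⟨P, -, hP, hPl⟩ := Ideal.exists_ideal_over_prime_of_isIntegral
      (S := S) l.head.asIdeal ⊥ (by
        rw [← RingHom.ker_eq_comap_bot, (RingHom.injective_iff_ker_eq_bot _).mp hinj]
        exact bot_le)
    have : P.LiesOver l.head.asIdeal := ⟨hPl.symm⟩
    obtain ⟨L, hL, -⟩ := Ideal.exists_ltSeries_of_hasGoingUp l P
    rw [← hL]
    exact Order.LTSeries.length_le_krullDim L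

/-- The Krull dimension of an affine domain is its transcendence degree. -/
theorem ringKrullDim_eq_of_trdeg_eq {k S : Type*} [Field k] [CommRing S] [IsDomain S]
    [Algebra k S] [Algebra.FiniteType k S] {n : ℕ} (h : Algebra.trdeg k S = n) :
    ringKrullDim S = n := by
  obtain ⟨s, g, hg, hint⟩ := exists_integral_inj_algHom_of_fg k S
  algebraize [g.toRingHom]
  have : Algebra.IsIntegral (MvPolynomial (Fin s) k) S := ⟨hint⟩
  have hinj : Function.Injective (algebraMap (MvPolynomial (Fin s) k) S) := hg
  have : FaithfulSMul (MvPolynomial (Fin s) k) S :=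
    (faithfulSMul_iff_algebraMap_injective _ _).mpr hinj
  have : IsScalarTower k (MvPolynomial (Fin s) k) S :=
    .of_algebraMap_eq fun x => (g.commutes x).symm
  have hs : s = n := by
    have := lift_trdeg_add_eq k (MvPolynomial (Fin s) k) S
    rw [h, trdeg_eq_zero (R := MvPolynomial (Fin s) k)] at this
    simpa using this
  rw [ringKrullDim_eq_of_isIntegral_of_injective hinj,
    MvPolynomial.ringKrullDim_of_isNoetherianRing, ringKrullDim_eq_zero_of_field]
  simp [hs]

end KrullDim

section MonomialMap

variable {k σ τ : Type*} [Field k]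

/-- The algebra map sending each variable `w` to the monomial with exponent vector `a w`. -/
noncomputable def monomialMap (k : Type*) [Field k] {σ τ : Type*} (a : σ → τ →₀ ℕ) :
    MvPolynomial σ k →ₐ[k] MvPolynomial τ k :=
  aeval fun w => monomial (a w) 1

theorem monomialMap_monomial (a : σ → τ →₀ ℕ) (e : σ →₀ ℕ) (c : k) :
    monomialMap k a (monomial e c) = monomial (Finsupp.linearCombination ℕ a e) c := by
  rw [monomialMap, aeval_monomial, Finsupp.linearCombination_apply, ← mul_one c,
    ← C_mul_monomial, mul_one, ← algebraMap_eq, Finsupp.sum, monomial_sum_one]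
  simp [Finsupp.prod, monomial_pow]

/-- An ideal containing all binomials `z^e - z^e'` with equal images under a monomial map
contains its kernel. -/
theorem ker_monomialMap_le (a : σ → τ →₀ ℕ) (I : Ideal (MvPolynomial σ k))
    (h : ∀ e e', Finsupp.linearCombination ℕ a e = Finsupp.linearCombination ℕ a e' →
      Ideal.Quotient.mk I (monomial e 1) = Ideal.Quotient.mk I (monomial e' 1)) :
    RingHom.ker (monomialMap k a) ≤ I := by
  let s : (τ →₀ ℕ) → (σ →₀ ℕ) := Function.invFun (Finsupp.linearCombination ℕ a)
  let θ : MvPolynomial τ k →ₗ[k] MvPolynomial σ k ⧸ I :=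
    (basisMonomials τ k).constr k fun m => Ideal.Quotient.mk I (monomial (s m) 1)
  have hθ : θ ∘ₗ (monomialMap k a).toLinearMap = (Ideal.Quotient.mkₐ k I).toLinearMap := by
    refine (basisMonomials σ k).ext fun e => ?_
    simp only [coe_basisMonomials, LinearMap.comp_apply, AlgHom.toLinearMap_apply,
      monomialMap_monomial, Ideal.Quotient.mkₐ_eq_mk]
    rw [← congrFun (coe_basisMonomials τ k), Module.Basis.constr_basis]
    exact h _ _ (Function.invFun_eq ⟨e, rfl⟩)
  intro f hf
  rw [← Ideal.Quotient.eq_zero_iff_mem]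
  have := LinearMap.congr_fun hθ f
  simp only [LinearMap.comp_apply, AlgHom.toLinearMap_apply, Ideal.Quotient.mkₐ_eq_mk] at this
  rw [← this, (RingHom.mem_ker).mp hf, map_zero]

theorem monomialMap_injective (a : σ → τ →₀ ℕ)
    (h : Function.Injective (Finsupp.linearCombination ℕ a)) :
    Function.Injective (monomialMap k a) := by
  rw [RingHom.injective_iff_ker_eq_bot, eq_bot_iff]
  exact ker_monomialMap_le a ⊥ fun e e' he => by rw [h he]

end MonomialMap

section Exchange

/-- The exponent vector of `tᵢ xₖ xₗ`. -/
noncomputable def tripleExp (i : Fin 2) (k l : Fin 4) : Fin 2 ⊕ Fin 4 →₀ ℕ :=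
  Finsupp.single (.inl i) 1 + Finsupp.single (.inr k) 1 + Finsupp.single (.inr l) 1

theorem tripleExp_comm (i : Fin 2) (k l : Fin 4) : tripleExp i k l = tripleExp i l k := by
  simp only [tripleExp]; abel

/-- The exponent vector of the image `tᵢ xₖ xₗ` of the variable `z_{i,kl}`. -/
noncomputable def zExp (w : ZVar) : Fin 2 ⊕ Fin 4 →₀ ℕ := tripleExp w.1 w.2.1.1 w.2.1.2

/-- The index of the variable `z_{i,kl}`, for arbitrary `k, l`. -/
def zIdx (i : Fin 2) (k l : Fin 4) : ZVar := (i, ⟨(min k l, max k l), min_le_max⟩)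

theorem zIdx_comm (i : Fin 2) (k l : Fin 4) : zIdx i k l = zIdx i l k := by
  simp only [zIdx, min_comm, max_comm]

theorem zIdx_self (w : ZVar) : zIdx w.1 w.2.1.1 w.2.1.2 = w := by
  obtain ⟨i, ⟨⟨k, l⟩, h⟩⟩ := w
  simp only [zIdx, min_eq_left h, max_eq_right h]

theorem zExp_zIdx (i : Fin 2) (k l : Fin 4) : zExp (zIdx i k l) = tripleExp i k l := by
  rcases le_total k l with h | h
  · simp [zExp, zIdx, h]
  · simp [zExp, zIdx, h, tripleExp_comm]

/-- The exponent vector of the image of a monomial of `R₁`. -/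
noncomputable abbrev monExp : (ZVar →₀ ℕ) →ₗ[ℕ] (Fin 2 ⊕ Fin 4 →₀ ℕ) :=
  Finsupp.linearCombination ℕ zExp

/-- The class of a monomial of `R₁` modulo the `2 × 2` minors of `M₁`. -/
noncomputable def monClass (e : ZVar →₀ ℕ) : R1 ⧸ minors2 M1 :=
  Ideal.Quotient.mk (minors2 M1) (monomial e 1)

theorem monClass_add (e e' : ZVar →₀ ℕ) : monClass (e + e') = monClass e * monClass e' := by
  simp [monClass, ← map_mul, monomial_mul]

theorem monClass_single (i : Fin 2) (k l : Fin 4) :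
    monClass (Finsupp.single (zIdx i k l) 1) = Ideal.Quotient.mk (minors2 M1) (zVar i k l) := rfl

theorem exists_M1_eq (i : Fin 2) (l : Fin 4) : ∃ c, ∀ k, M1 k c = zVar i k l := by
  fin_cases i
  · refine ⟨⟨l, by lia⟩, fun k => ?_⟩
    simp [M1, Nat.mod_eq_of_lt l.isLt]
  · refine ⟨⟨l + 4, by lia⟩, fun k => ?_⟩
    simp [M1, Nat.mod_eq_of_lt l.isLt]

theorem monClass_exchange (i j : Fin 2) (k l m n : Fin 4) :
    monClass (Finsupp.single (zIdx i k l) 1) * monClass (Finsupp.single (zIdx j m n) 1) =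
      monClass (Finsupp.single (zIdx i m l) 1) * monClass (Finsupp.single (zIdx j k n) 1) := by
  obtain ⟨c, hc⟩ := exists_M1_eq i l
  obtain ⟨d, hd⟩ := exists_M1_eq j n
  simp only [monClass_single, ← map_mul]
  rw [Ideal.Quotient.mk_eq_mk_iff_sub_mem]
  refine Ideal.subset_span ⟨k, m, c, d, ?_⟩
  rw [hc, hc, hd, hd]
  ring

theorem sum_monExp_inl (e : ZVar →₀ ℕ) : ∑ i, monExp e (.inl i) = e.degree := by
  induction e using Finsupp.induction_linear with
  | zero => simp
  | add f g hf hg => simp only [map_add, Finsupp.add_apply, Finset.sum_add_distrib, hf, hg]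
  | single w n => simp [zExp, tripleExp, Finsupp.single_apply]

theorem sum_monExp_inr (e : ZVar →₀ ℕ) : ∑ k, monExp e (.inr k) = 2 * e.degree := by
  induction e using Finsupp.induction_linear with
  | zero => simp
  | add f g hf hg => simp only [map_add, Finsupp.add_apply, Finset.sum_add_distrib, hf, hg, mul_add]
  | single w n =>
    simp [zExp, tripleExp, Finsupp.single_apply, Finset.sum_add_distrib, two_mul]

theorem exists_eq_add_single_of_monExp_ne_zero {e : ZVar →₀ ℕ} {p : Fin 2 ⊕ Fin 4}
    (h : monExp e p ≠ 0) : ∃ e₀ w, e = e₀ + Finsupp.single w 1 ∧ zExp w p ≠ 0 := by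
  rw [Finsupp.linearCombination_apply, Finsupp.sum_apply] at h
  obtain ⟨w, hw, hne⟩ := Finset.exists_ne_zero_of_sum_ne_zero h
  rw [Finsupp.mem_support_iff] at hw
  refine ⟨e - Finsupp.single w 1, w, (tsub_add_cancel_of_le ?_).symm, fun h0 => hne (by simp [h0])⟩
  rw [Finsupp.single_le_iff]
  lia

theorem exists_single_of_monExp_inr_ne_zero {e : ZVar →₀ ℕ} {k : Fin 4}
    (h : monExp e (.inr k) ≠ 0) : ∃ e₀ j d, e = e₀ + Finsupp.single (zIdx j k d) 1 := by
  obtain ⟨e₀, w, rfl, hw⟩ := exists_eq_add_single_of_monExp_ne_zero h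
  rw [← zIdx_self w]
  have : w.2.1.1 = k ∨ w.2.1.2 = k := by
    by_contra! hne
    simp [zExp, tripleExp, hne.1, hne.2] at hw
  obtain rfl | rfl := this
  · exact ⟨e₀, w.1, w.2.1.2, rfl⟩
  · exact ⟨e₀, w.1, w.2.1.1, by rw [zIdx_comm]⟩

/-- Modulo the minors, the index `a` of a factor `z_{i,ab}` can be exchanged against any index `k`
occurring in the monomial. -/
theorem exists_exchange_s2 {v : ZVar →₀ ℕ} {i : Fin 2} {a b k : Fin 4}
    (h : a = k ∨ monExp v (.inr k) ≠ 0) :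
    ∃ v', monClass (v + Finsupp.single (zIdx i a b) 1) =
        monClass (v' + Finsupp.single (zIdx i k b) 1) ∧
      monExp (v + Finsupp.single (zIdx i a b) 1) =
        monExp (v' + Finsupp.single (zIdx i k b) 1) := by
  obtain rfl | h := h
  · exact ⟨v, rfl, rfl⟩
  obtain ⟨e₀, j, d, rfl⟩ := exists_single_of_monExp_inr_ne_zero h
  refine ⟨e₀ + Finsupp.single (zIdx j a d) 1, ?_, ?_⟩
  · simp only [monClass_add, mul_assoc]
    rw [monClass_exchange]
  · simp only [map_add, Finsupp.linearCombination_single, one_smul, zExp_zIdx, tripleExp]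
    abel

theorem exists_factor {e : ZVar →₀ ℕ} {w : ZVar} (h : zExp w ≤ monExp e) :
    ∃ u, monClass e = monClass (u + Finsupp.single w 1) ∧
      monExp e = monExp (u + Finsupp.single w 1) := by
  obtain ⟨i, k, l, rfl⟩ : ∃ i k l, w = zIdx i k l := ⟨_, _, _, (zIdx_self w).symm⟩
  rw [zExp_zIdx] at h
  obtain ⟨e₀, w', rfl, hw'⟩ := exists_eq_add_single_of_monExp_ne_zero (e := e) (p := .inl i) (by
    have := h (.inl i)
    simp [tripleExp] at this
    lia)
  obtain ⟨j, a, b, rfl⟩ : ∃ i k l, w' = zIdx i k l := ⟨_, _, _, (zIdx_self w').symm⟩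
  obtain rfl : j = i := by
    by_contra hne
    simp [zExp_zIdx, tripleExp, hne] at hw'
  obtain ⟨v, b', hv, hv'⟩ : ∃ v b',
      monClass (e₀ + Finsupp.single (zIdx j a b) 1) =
        monClass (v + Finsupp.single (zIdx j k b') 1) ∧
      monExp (e₀ + Finsupp.single (zIdx j a b) 1) =
        monExp (v + Finsupp.single (zIdx j k b') 1) := by
    by_cases hkb : b = k
    · exact ⟨e₀, a, by rw [hkb, zIdx_comm], by rw [hkb, zIdx_comm]⟩
    · obtain ⟨v, hv⟩ := exists_exchange_s2 (v := e₀) (i := j) (a := a) (b := b) (k := k) (by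
        have := h (.inr k)
        by_contra! hne
        simp [zExp_zIdx, tripleExp, hkb, hne] at this)
      exact ⟨v, b, hv⟩
  rw [hv'] at h
  obtain ⟨u, hu, hu'⟩ := exists_exchange_s2 (v := v) (i := j) (a := b') (b := k) (k := l) (by
    have := h (.inr l)
    by_contra! hne
    simp [zExp_zIdx, tripleExp, hne] at this)
  rw [hv, hv', zIdx_comm j k b', zIdx_comm j k l]
  exact ⟨u, hu, hu'⟩

theorem monClass_eq_of_monExp_eq (e e' : ZVar →₀ ℕ) (h : monExp e = monExp e') :
    monClass e = monClass e' := by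
  induction hn : e'.degree generalizing e e' with
  | zero =>
    obtain rfl : e' = 0 := (Finsupp.degree_eq_zero_iff e').mp hn
    obtain rfl : e = 0 := by
      rw [← Finsupp.degree_eq_zero_iff, ← sum_monExp_inl, h]
      simp
    rfl
  | succ n ih =>
    obtain ⟨w, hw⟩ : ∃ w, e' w ≠ 0 := by
      by_contra! h0
      obtain rfl : e' = 0 := Finsupp.ext h0
      simp at hn
    obtain ⟨v, rfl⟩ : ∃ v, e' = v + Finsupp.single w 1 :=
      ⟨e' - Finsupp.single w 1, (tsub_add_cancel_of_le (by
        rw [Finsupp.single_le_iff]; lia)).symm⟩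
    obtain ⟨u, hu, hu'⟩ := exists_factor (e := e) (w := w) (by
      rw [h, map_add, Finsupp.linearCombination_single, one_smul]
      exact le_add_self)
    rw [hu, monClass_add, monClass_add, ih u v]
    · rw [hu', map_add, map_add] at h
      exact add_right_cancel h
    · simpa using hn

end Exchange

section Dehomogenization

/-- Setting `x₁ = 1` on exponent vectors. -/
noncomputable def dehom : (Fin 2 ⊕ Fin 4 →₀ ℕ) →ₗ[ℕ] (Fin 2 ⊕ Fin 3 →₀ ℕ) :=
  Finsupp.lcomapDomain (Sum.map id Fin.succ)
    (Function.Injective.sumMap Function.injective_id (Fin.succ_injective 3))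

theorem dehom_inl (e : Fin 2 ⊕ Fin 4 →₀ ℕ) (i : Fin 2) : dehom e (.inl i) = e (.inl i) := rfl

theorem dehom_inr (e : Fin 2 ⊕ Fin 4 →₀ ℕ) (k : Fin 3) : dehom e (.inr k) = e (.inr k.succ) := rfl

theorem linearCombination_dehom (e : ZVar →₀ ℕ) :
    Finsupp.linearCombination ℕ (fun w => dehom (zExp w)) e = dehom (monExp e) :=
  (Finsupp.apply_linearCombination ℕ dehom zExp e).symm

theorem monExp_eq_of_dehom_eq {e e' : ZVar →₀ ℕ} (h : dehom (monExp e) = dehom (monExp e')) :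
    monExp e = monExp e' := by
  have hl (i : Fin 2) : monExp e (.inl i) = monExp e' (.inl i) := DFunLike.congr_fun h (.inl i)
  have hr (k : Fin 3) : monExp e (.inr k.succ) = monExp e' (.inr k.succ) :=
    DFunLike.congr_fun h (.inr k)
  have hsum : ∑ k, monExp e (.inr k) = ∑ k, monExp e' (.inr k) := by
    rw [sum_monExp_inr, sum_monExp_inr, ← sum_monExp_inl, ← sum_monExp_inl]
    simp only [hl]
  rw [Fin.sum_univ_succ, Fin.sum_univ_succ] at hsum
  simp only [hr] at hsum
  replace hsum := add_right_cancel hsum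
  ext p
  rcases p with i | k
  · exact hl i
  · exact Fin.cases hsum hr k

/-- The dehomogenization at `x₁ = 1` of the map `z_{i,kl} ↦ tᵢ xₖ xₗ`. -/
noncomputable abbrev dehomMap : R1 →ₐ[ℂ] MvPolynomial (Fin 2 ⊕ Fin 3) ℂ :=
  monomialMap ℂ fun w => dehom (zExp w)

theorem dehomMap_zVar (i : Fin 2) (k l : Fin 4) :
    dehomMap (zVar i k l) = monomial (dehom (tripleExp i k l)) 1 := by
  rw [← zExp_zIdx]
  exact aeval_X _ _

theorem ker_dehomMap : RingHom.ker dehomMap = minors2 M1 := by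
  apply le_antisymm
  · refine ker_monomialMap_le _ _ fun e e' h => monClass_eq_of_monExp_eq e e' ?_
    rw [linearCombination_dehom, linearCombination_dehom] at h
    exact monExp_eq_of_dehom_eq h
  · refine Ideal.span_le.mpr ?_
    rintro _ ⟨k, m, c, d, rfl⟩
    rw [SetLike.mem_coe, RingHom.mem_ker]
    simp only [M1, map_sub, map_mul, dehomMap_zVar, monomial_mul, ← map_add, one_mul, sub_eq_zero]
    refine congrArg (fun e => monomial (dehom e) (1 : ℂ)) ?_
    simp only [tripleExp]
    abel

theorem trdeg_quotient_ker_dehomMap : Algebra.trdeg ℂ (R1 ⧸ RingHom.ker dehomMap) = 5 := by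
  apply le_antisymm
  · refine (trdeg_le_of_injective (Ideal.kerLiftAlg dehomMap)
      (Ideal.kerLiftAlg_injective dehomMap)).trans ?_
    rw [MvPolynomial.trdeg_of_isDomain]
    simp
  · let w : Fin 5 → ZVar := ![zIdx 0 0 0, zIdx 1 0 0, zIdx 0 0 1, zIdx 0 0 2, zIdx 0 0 3]
    have hinj : Function.Injective
        (Finsupp.linearCombination ℕ fun i => dehom (zExp (w i))) := by
      intro e e' h
      have h' (p) := DFunLike.congr_fun h p
      simp only [Finsupp.linearCombination_apply, Finsupp.sum_fintype, zero_smul, implies_true,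
        Fin.sum_univ_five] at h'
      have h0 := h' (.inl 0)
      have h1 := h' (.inl 1)
      have h2 := h' (.inr 0)
      have h3 := h' (.inr 1)
      have h4 := h' (.inr 2)
      simp [w, zExp_zIdx, dehom_inl, dehom_inr, tripleExp] at h0 h1 h2 h3 h4
      ext i
      fin_cases i <;> simp <;> lia
    have hw : AlgebraicIndependent ℂ fun i =>
        Ideal.Quotient.mk (RingHom.ker dehomMap) (X (w i)) := by
      refine AlgebraicIndependent.of_comp (Ideal.kerLiftAlg dehomMap) ?_
      have hcomp : (Ideal.kerLiftAlg dehomMap ∘ fun i =>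
          Ideal.Quotient.mk (RingHom.ker dehomMap) (X (w i))) =
            fun i => monomial (dehom (zExp (w i))) (1 : ℂ) :=
        funext fun i => (Ideal.kerLiftAlg_mk _ _).trans (aeval_X _ _)
      rw [hcomp, algebraicIndependent_iff_injective_aeval]
      exact monomialMap_injective _ hinj
    simpa using hw.cardinalMk_le_trdeg

end Dehomogenization

/-- The ideal of `R₁` generated by the `2 × 2` minors of `M₁` is prime, and
the quotient ring has Krull dimension `5` (the affine cone over the 4-dimensional irreducible
projective variety `φ₁(ℙ¹ × ℙ³) ⊂ ℙ¹⁹`). -/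
theorem minors2_M1_prime_and_dim :
    (minors2 M1).IsPrime ∧ ringKrullDim (R1 ⧸ minors2 M1) = 5 := by
  rw [← ker_dehomMap]
  have := RingHom.ker_isPrime dehomMap
  exact ⟨this, ringKrullDim_eq_of_trdeg_eq trdeg_quotient_ker_dehomMap⟩
end

section
/- For every t ∈ ℂ with t ≠ 0, there is an isomorphism of graded ℂ-algebras between R₀ / (ideal generated by the 2×2 minors of N_t) and R₁ / (ideal generated by the 2×2 minors of M₁); in particular, for t ≠ 0 the projective variety cut out in ℙ¹⁹ by the 2×2 minors of N_t is isomorphic to ℙ¹ × ℙ³ in its Segre–Veronese embedding. -/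
open MvPolynomial

/-- The twists `(a₁, a₂, a₃, a₄) = (0, 1, 1, 2)` of the weighted scroll `𝔽(0,1,1,2)`. -/
def av : Fin 4 → ℕ := ![0, 1, 1, 2]

/-- The index set `Λ` of the 20 monomials `t₁^i t₂^j x_m x_n` with `m ≤ n` and
`i + j = a_m + a_n - 1`, spanning the half-anticanonical system of `𝔽(0,1,1,2)`. -/
abbrev Lam : Type :=
  {q : ℕ × ℕ × Fin 4 × Fin 4 // q.2.2.1 ≤ q.2.2.2 ∧ q.1 + q.2.1 + 1 = av q.2.2.1 + av q.2.2.2}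

/-- The polynomial ring `R₀ = ℂ[y_w : w ∈ Λ]` in 20 variables. -/
abbrev R0 : Type := MvPolynomial Lam ℂ

/-- The variable `y_w` of `R₀` attached to the monomial `w = t₁^i t₂^j x_m x_n ∈ Λ`
(and `0` if the data does not determine an element of `Λ`; all matrix entries below do). -/
noncomputable def yVar (i j : ℕ) (m n : Fin 4) : R0 :=
  if h : m ≤ n ∧ i + j + 1 = av m + av n then X ⟨(i, j, m, n), h⟩ else 0

/-- The ℂ-algebra homomorphism `ψ₀ : R₀ → ℂ[t₁,t₂,x₁,…,x₄]`, `y_w ↦ w`. -/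
noncomputable def psi0 : R0 →ₐ[ℂ] T6 :=
  aeval fun w : Lam =>
    (X 0) ^ w.1.1 * (X 1) ^ w.1.2.1 *
      X (⟨(w.1.2.2.1 : ℕ) + 2, Nat.add_lt_add_right w.1.2.2.1.isLt 2⟩ : Fin 6) *
      X (⟨(w.1.2.2.2 : ℕ) + 2, Nat.add_lt_add_right w.1.2.2.2.isLt 2⟩ : Fin 6)

/-- The row labels of `M₀` (and of `N_t`): the monomials `x₂, x₃, t₁x₄, t₂x₄`, each
recorded as `(i, j, m)` standing for `t₁^i t₂^j x_m` (with `x`-indices 0-based). -/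
def rowLab : Fin 4 → ℕ × ℕ × Fin 4 := ![(0, 0, 1), (0, 0, 2), (1, 0, 3), (0, 1, 3)]

/-- The column labels of `M₀`: the monomials
`x₁, t₁x₂, t₁x₃, t₂x₂, t₂x₃, t₁²x₄, t₁t₂x₄, t₂²x₄`. -/
def colLab : Fin 8 → ℕ × ℕ × Fin 4 :=
  ![(0, 0, 0), (1, 0, 1), (1, 0, 2), (0, 1, 1), (0, 1, 2), (2, 0, 3), (1, 1, 3), (0, 2, 3)]

/-- The `4 × 8` matrix `M₀` over `R₀`, with `(r, c)` entry the variable `y_{rc}` attached to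
the product of the row label `r` and the column label `c`. -/
noncomputable def M0 : Matrix (Fin 4) (Fin 8) R0 := fun r c =>
  yVar ((rowLab r).1 + (colLab c).1) ((rowLab r).2.1 + (colLab c).2.1)
    (min (rowLab r).2.2 (colLab c).2.2) (max (rowLab r).2.2 (colLab c).2.2)

/-- The column labels of the `4 × 9` matrix `N_t`: the monomials
`x₁, t₁x₂, t₁x₃, t₁²x₄, t₁t₂x₄, t₂x₂, t₂x₃, t₁t₂x₄, t₂²x₄`
(note the column `t₁t₂x₄` appears twice). -/
def colLab9 : Fin 9 → ℕ × ℕ × Fin 4 :=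
  ![(0, 0, 0), (1, 0, 1), (1, 0, 2), (2, 0, 3), (1, 1, 3),
    (0, 1, 1), (0, 1, 2), (1, 1, 3), (0, 2, 3)]

/-- The variable `y_{r_s x₁}` attached to the product of the `s`-th row label with `x₁`. -/
noncomputable def yRow1 (s : Fin 4) : R0 :=
  yVar (rowLab s).1 (rowLab s).2.1 0 (rowLab s).2.2

/-- The matrix of modification terms of `N_t`: for `s = 1, …, 4` the entries at positions
`(4, 1+s)` and `(s, 5)` have `t·y_{r_s x₁}` added, and the entries at positions `(3, 5+s)`
and `(s, 8)` have `t·y_{r_s x₁}` subtracted; the overlapping positions `(4,5)` and `(3,8)`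
each receive a single modification. (Positions here are 1-based as in the paper.) -/
noncomputable def modTerm (t : ℂ) : Matrix (Fin 4) (Fin 9) R0 :=
  Matrix.of
    ![![0, 0, 0, 0, C t * yRow1 0, 0, 0, -(C t * yRow1 0), 0],
      ![0, 0, 0, 0, C t * yRow1 1, 0, 0, -(C t * yRow1 1), 0],
      ![0, 0, 0, 0, C t * yRow1 2, -(C t * yRow1 0), -(C t * yRow1 1),
        -(C t * yRow1 2), -(C t * yRow1 3)],
      ![0, C t * yRow1 0, C t * yRow1 1, C t * yRow1 2, C t * yRow1 3, 0, 0,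
        -(C t * yRow1 3), 0]]

/-- The `4 × 9` matrix `N_t` over `R₀`: base entry `y_{rc}` at position `(r, c)`,
modified by the terms `± t·y_{r_s x₁}` as described above. -/
noncomputable def Nmat (t : ℂ) : Matrix (Fin 4) (Fin 9) R0 := fun r c =>
  yVar ((rowLab r).1 + (colLab9 c).1) ((rowLab r).2.1 + (colLab9 c).2.1)
    (min (rowLab r).2.2 (colLab9 c).2.2) (max (rowLab r).2.2 (colLab9 c).2.2)
    + modTerm t r c

/-- If every column of `N` is a linear combination of the columns of `M`, then the `2 × 2` minors
of `N` lie in the ideal of `2 × 2` minors of `M`. -/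
theorem minors2_le_of_col_eq_mulVec {R m n p : Type*} [CommRing R] [Fintype n]
    {M : Matrix m n R} {N : Matrix m p R} (h : ∀ c, ∃ v : n → R, N.col c = M.mulVec v) :
    minors2 N ≤ minors2 M := by
  refine Ideal.span_le.2 ?_
  rintro _ ⟨i₁, i₂, j₁, j₂, rfl⟩
  obtain ⟨v, hv⟩ := h j₁
  obtain ⟨w, hw⟩ := h j₂
  have hv' : ∀ i, N i j₁ = ∑ a, M i a * v a := fun i => congrFun hv i
  have hw' : ∀ i, N i j₂ = ∑ b, M i b * w b := fun i => congrFun hw i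
  have key : N i₁ j₁ * N i₂ j₂ - N i₁ j₂ * N i₂ j₁ =
      ∑ a, ∑ b, v a * w b * (M i₁ a * M i₂ b - M i₁ b * M i₂ a) := by
    rw [hv', hw', hv', hw', mul_comm (∑ b, M i₁ b * w b), Finset.sum_mul_sum, Finset.sum_mul_sum,
      ← Finset.sum_sub_distrib]
    refine Finset.sum_congr rfl fun a _ => ?_
    rw [← Finset.sum_sub_distrib]
    exact Finset.sum_congr rfl fun b _ => by ring
  rw [SetLike.mem_coe, key]
  exact sum_mem fun a _ => sum_mem fun b _ =>
    Ideal.mul_mem_left _ _ (Ideal.subset_span ⟨i₁, i₂, a, b, rfl⟩)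

theorem map_minors2 {R S m n : Type*} [CommRing R] [CommRing S] (f : R →+* S)
    (M : Matrix m n R) : (minors2 M).map f = minors2 (M.map f) := by
  rw [minors2, Ideal.map_span, minors2]
  congr 1
  ext x
  constructor
  · rintro ⟨_, ⟨i₁, i₂, j₁, j₂, rfl⟩, rfl⟩
    exact ⟨i₁, i₂, j₁, j₂, by simp⟩
  · rintro ⟨i₁, i₂, j₁, j₂, rfl⟩
    exact ⟨_, ⟨i₁, i₂, j₁, j₂, rfl⟩, by simp⟩

theorem C_ofNat_eq {σ R : Type*} [CommSemiring R] (n : ℕ) [n.AtLeastTwo] :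
    (C (ofNat(n) : R) : MvPolynomial σ R) = ofNat(n) :=
  map_ofNat C n

/-- The fifth and eighth columns of `N_t` differ by `2t` times the first one. -/
theorem Nmat_sub (t : ℂ) (k : Fin 4) :
    Nmat t k 4 - Nmat t k 7 = C (2 * t) * Nmat t k 0 := by
  fin_cases k <;> simp [Nmat, modTerm, yRow1, rowLab, colLab9, C_ofNat_eq] <;> ring

theorem minors2_Nmat {t : ℂ} (ht : t ≠ 0) :
    minors2 (Nmat t) = minors2 ((Nmat t).submatrix id Fin.succ) := by
  apply le_antisymm
  · refine minors2_le_of_col_eq_mulVec fun c => ?_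
    induction c using Fin.cases with
    | zero =>
      refine ⟨(C (2 * t)⁻¹ : R0) • (Pi.single 3 1 - Pi.single 6 1 : Fin 8 → R0), ?_⟩
      ext1 k
      rw [Matrix.mulVec_smul, Matrix.mulVec_sub, Matrix.mulVec_single_one,
        Matrix.mulVec_single_one]
      change Nmat t k 0 = C (2 * t)⁻¹ * (Nmat t k 4 - Nmat t k 7)
      rw [Nmat_sub, ← mul_assoc, ← C_mul, inv_mul_cancel₀ (by simpa using ht), C_1, one_mul]
    | succ c =>
      exact ⟨Pi.single c 1, by rw [Matrix.mulVec_single_one]; rfl⟩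
  · exact minors2_le_of_col_eq_mulVec fun c =>
      ⟨Pi.single c.succ 1, by rw [Matrix.mulVec_single_one]; rfl⟩

/-- The linear substitution `R₁ → R₀` sending `M₁` to the last eight columns of `N_t`. -/
noncomputable def toR0 (t : ℂ) : R1 →ₐ[ℂ] R0 :=
  aeval fun z : ZVar => Nmat t z.2.1.1 (![![1, 2, 3, 4], ![5, 6, 7, 8]] z.1 z.2.1.2)

/-- The linear form in the `z_{i,kl}` corresponding to `y_w`, given the exponents of `w`. -/
noncomputable def linForm (t : ℂ) : ℕ × ℕ × Fin 4 × Fin 4 → R1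
  | (0, 0, 0, 1) => C (2 * t)⁻¹ * (zVar 0 0 3 - zVar 1 0 2)
  | (0, 0, 0, 2) => C (2 * t)⁻¹ * (zVar 0 1 3 - zVar 1 1 2)
  | (1, 0, 0, 3) => C (2 * t)⁻¹ * (zVar 0 2 3 - zVar 1 2 2)
  | (0, 1, 0, 3) => C (2 * t)⁻¹ * (zVar 0 3 3 - zVar 1 2 3)
  | (1, 0, 1, 1) => zVar 0 0 0
  | (0, 1, 1, 1) => zVar 1 0 0
  | (1, 0, 1, 2) => zVar 0 0 1
  | (0, 1, 1, 2) => zVar 1 0 1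
  | (1, 0, 2, 2) => zVar 0 1 1
  | (0, 1, 2, 2) => zVar 1 1 1
  | (2, 0, 1, 3) => zVar 0 0 2
  | (1, 1, 1, 3) => C 2⁻¹ * (zVar 0 0 3 + zVar 1 0 2)
  | (0, 2, 1, 3) => zVar 1 0 3
  | (2, 0, 2, 3) => zVar 0 1 2
  | (1, 1, 2, 3) => C 2⁻¹ * (zVar 0 1 3 + zVar 1 1 2)
  | (0, 2, 2, 3) => zVar 1 1 3
  | (3, 0, 3, 3) => zVar 0 2 2
  | (2, 1, 3, 3) => C 2⁻¹ * (zVar 0 2 3 + zVar 1 2 2)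
  | (1, 2, 3, 3) => C 2⁻¹ * (zVar 0 3 3 + zVar 1 2 3)
  | (0, 3, 3, 3) => zVar 1 3 3
  | _ => 0

/-- The linear substitution `R₀ → R₁` inverse to `toR0` when `t ≠ 0`. -/
noncomputable def toR1 (t : ℂ) : R0 →ₐ[ℂ] R1 := aeval fun w : Lam => linForm t w.1

theorem toR0_zVar (t : ℂ) (i : Fin 2) (k l : Fin 4) :
    toR0 t (zVar i k l) = Nmat t k (![![1, 2, 3, 4], ![5, 6, 7, 8]] i l) := by
  simp only [toR0, zVar, aeval_X]
  fin_cases i <;> fin_cases k <;> fin_cases l <;>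
    simp [Nmat, modTerm, yRow1, rowLab, colLab9]

theorem map_M1_toR0 (t : ℂ) : M1.map (toR0 t) = (Nmat t).submatrix id Fin.succ := by
  ext1 k c
  rw [Matrix.map_apply, M1, toR0_zVar]
  fin_cases c <;> rfl

theorem toR1_yVar (t : ℂ) {i j : ℕ} {m n : Fin 4} (h : m ≤ n ∧ i + j + 1 = av m + av n) :
    toR1 t (yVar i j m n) = linForm t (i, j, m, n) := by
  rw [yVar, dif_pos h, toR1, aeval_X]

theorem C_inv_two_mul_two (σ : Type*) : (C 2⁻¹ * 2 : MvPolynomial σ ℂ) = 1 := by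
  rw [← C_ofNat_eq, ← C_mul, inv_mul_cancel₀ two_ne_zero, C_1]

theorem C_mul_C_two_mul_inv (σ : Type*) {t : ℂ} (ht : t ≠ 0) :
    (C t * C (2 * t)⁻¹ : MvPolynomial σ ℂ) = C 2⁻¹ := by
  rw [← C_mul]
  congr 1
  field_simp

theorem C_inv_two_mul_add {σ : Type*} {t : ℂ} (ht : t ≠ 0) (a b : MvPolynomial σ ℂ) :
    C 2⁻¹ * (a + b) + C t * (C (2 * t)⁻¹ * (a - b)) = a := by
  linear_combination (a - b) * C_mul_C_two_mul_inv σ ht + a * C_inv_two_mul_two σ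

theorem C_inv_two_mul_sub {σ : Type*} {t : ℂ} (ht : t ≠ 0) (a b : MvPolynomial σ ℂ) :
    C 2⁻¹ * (a + b) - C t * (C (2 * t)⁻¹ * (a - b)) = b := by
  linear_combination C_inv_two_mul_add ht b a

theorem toR1_comp_toR0 {t : ℂ} (ht : t ≠ 0) : (toR1 t).comp (toR0 t) = AlgHom.id ℂ R1 := by
  apply MvPolynomial.algHom_ext
  rintro ⟨i, ⟨k, l⟩, hkl⟩
  have hX : (X (i, ⟨(k, l), hkl⟩) : R1) = zVar i k l := by
    have hkl' : k ≤ l := hkl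
    simp [zVar, hkl']
  rw [hX, AlgHom.comp_apply, toR0_zVar, AlgHom.id_apply]
  have hC (p : R0) : toR1 t (C t * p) = C t * toR1 t p := by
    rw [map_mul]
    exact congrArg (· * _) ((toR1 t).commutes t)
  clear hX
  fin_cases i <;> fin_cases k <;> fin_cases l <;>
    try exact absurd hkl (by decide)
  all_goals
    simp (disch := decide) [Nmat, modTerm, yRow1, rowLab, colLab9, toR1_yVar, linForm, hC,
      -C_mul, -map_mul, C_inv_two_mul_add ht, C_inv_two_mul_sub ht, ← sub_eq_add_neg, -mul_inv_rev]

theorem C_two_mul_inv_mul_add_self {σ : Type*} {t : ℂ} (ht : t ≠ 0) (a : MvPolynomial σ ℂ) :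
    C (2 * t)⁻¹ * (C t * a + C t * a) = a := by
  linear_combination 2 * a * C_mul_C_two_mul_inv σ ht + a * C_inv_two_mul_two σ

theorem C_inv_two_mul_add_self {σ : Type*} (a : MvPolynomial σ ℂ) :
    C 2⁻¹ * (a + a) = a := by
  linear_combination a * C_inv_two_mul_two σ

theorem toR0_comp_toR1 {t : ℂ} (ht : t ≠ 0) : (toR0 t).comp (toR1 t) = AlgHom.id ℂ R0 := by
  apply MvPolynomial.algHom_ext
  rintro ⟨⟨i, j, m, n⟩, h⟩
  have hX : (X ⟨(i, j, m, n), h⟩ : R0) = yVar i j m n := by rw [yVar, dif_pos h]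
  rw [hX, AlgHom.comp_apply, toR1_yVar t h, AlgHom.id_apply]
  have hC (p : R1) (c : ℂ) : toR0 t (C c * p) = C c * toR0 t p := by
    rw [map_mul]
    exact congrArg (· * _) ((toR0 t).commutes c)
  have hav : ∀ k, av k ≤ 2 := by decide
  have hij : i + j + 1 = av m + av n := h.2
  have hi : i ≤ 3 := by have := hav m; have := hav n; omega
  have hj : j ≤ 3 := by have := hav m; have := hav n; omega
  clear hX hij
  interval_cases i <;> interval_cases j <;> fin_cases m <;> fin_cases n <;>
    try exact absurd h (by decide)
  all_goals
    simp [linForm, hC, toR0_zVar, Nmat, modTerm, yRow1, rowLab, colLab9, -C_mul, -mul_inv_rev,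
      C_two_mul_inv_mul_add_self ht, C_inv_two_mul_add_self, ← sub_eq_add_neg]

theorem isHomogeneous_yVar (i j : ℕ) (m n : Fin 4) : (yVar i j m n).IsHomogeneous 1 := by
  rw [yVar]
  split_ifs
  · exact isHomogeneous_X _ _
  · exact isHomogeneous_zero _ _ _

theorem isHomogeneous_C_mul_yRow1 (t : ℂ) (s : Fin 4) : (C t * yRow1 s).IsHomogeneous 1 :=
  (isHomogeneous_yVar _ _ _ _).C_mul t

theorem isHomogeneous_Nmat (t : ℂ) (k : Fin 4) (c : Fin 9) : (Nmat t k c).IsHomogeneous 1 := by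
  refine (isHomogeneous_yVar _ _ _ _).add ?_
  fin_cases k <;> fin_cases c <;>
    first
    | exact isHomogeneous_zero _ _ _
    | exact isHomogeneous_C_mul_yRow1 _ _
    | exact (isHomogeneous_C_mul_yRow1 _ _).neg

theorem isHomogeneous_zVar (i : Fin 2) (k l : Fin 4) : (zVar i k l).IsHomogeneous 1 :=
  isHomogeneous_X _ _

theorem isHomogeneous_linForm (t : ℂ) (q : ℕ × ℕ × Fin 4 × Fin 4) :
    (linForm t q).IsHomogeneous 1 := by
  unfold linForm
  split <;>
    first
    | with_reducible exact isHomogeneous_zVar _ _ _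
    | with_reducible exact isHomogeneous_zero ZVar ℂ _
    | with_reducible exact ((isHomogeneous_zVar _ _ _).add (isHomogeneous_zVar _ _ _)).C_mul _
    | exact ((isHomogeneous_zVar _ _ _).sub (isHomogeneous_zVar _ _ _)).C_mul _

theorem isHomogeneous_toR0 (t : ℂ) {p : R1} {m : ℕ} (hp : p.IsHomogeneous m) :
    (toR0 t p).IsHomogeneous m := by
  rw [toR0, ← one_mul m]
  exact hp.aeval _ fun _ => isHomogeneous_Nmat t _ _

theorem isHomogeneous_toR1 (t : ℂ) {p : R0} {m : ℕ} (hp : p.IsHomogeneous m) :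
    (toR1 t p).IsHomogeneous m := by
  rw [toR1, ← one_mul m]
  exact hp.aeval _ fun _ => isHomogeneous_linForm t _

/-- The graded isomorphism `R₀ ≅ R₁` given by the substitutions `toR1` and `toR0`. -/
noncomputable def coordEquiv {t : ℂ} (ht : t ≠ 0) : R0 ≃ₐ[ℂ] R1 :=
  AlgEquiv.ofAlgHom (toR1 t) (toR0 t) (toR1_comp_toR0 ht) (toR0_comp_toR1 ht)

theorem minors2_M1_eq_map {t : ℂ} (ht : t ≠ 0) :
    minors2 M1 = (minors2 (Nmat t)).map (coordEquiv ht : R0 →+* R1) := by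
  have h : (coordEquiv ht : R0 →+* R1).comp (toR0 t : R1 →+* R0) = RingHom.id R1 :=
    RingHom.ext fun p => DFunLike.congr_fun (toR1_comp_toR0 ht) p
  have h' : minors2 (Nmat t) = (minors2 M1).map (toR0 t : R1 →+* R0) := by
    rw [minors2_Nmat ht, map_minors2, ← map_M1_toR0]
    rfl
  rw [h', Ideal.map_map, h, Ideal.map_id]

/-- For every `t ≠ 0` there is an isomorphism of *graded* ℂ-algebras
`R₀/(∧²N_t) ≅ R₁/(∧²M₁)`: an algebra isomorphism carrying, for every `m`, the image of the
degree-`m` homogeneous part of `R₀` onto the image of the degree-`m` homogeneous part of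
`R₁`.  In particular, for `t ≠ 0` the projective variety cut out in `ℙ¹⁹` by the `2 × 2`
minors of `N_t` is isomorphic to `ℙ¹ × ℙ³` in its Segre–Veronese embedding. -/
theorem fibre_iso_of_ne_zero (t : ℂ) (ht : t ≠ 0) :
    ∃ e : (R0 ⧸ minors2 (Nmat t)) ≃ₐ[ℂ] (R1 ⧸ minors2 M1),
      ∀ m : ℕ,
        Submodule.map e.toLinearMap
          (Submodule.map (Ideal.Quotient.mkₐ ℂ (minors2 (Nmat t))).toLinearMap
            (MvPolynomial.homogeneousSubmodule Lam ℂ m)) =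
        Submodule.map (Ideal.Quotient.mkₐ ℂ (minors2 M1)).toLinearMap
          (MvPolynomial.homogeneousSubmodule ZVar ℂ m) := by
  refine ⟨Ideal.quotientEquivAlg _ _ (coordEquiv ht) (minors2_M1_eq_map ht), fun m => ?_⟩
  apply le_antisymm
  · rintro _ ⟨_, ⟨p, hp, rfl⟩, rfl⟩
    exact ⟨toR1 t p, isHomogeneous_toR1 t hp, rfl⟩
  · rintro _ ⟨p, hp, rfl⟩
    refine ⟨_, ⟨toR0 t p, isHomogeneous_toR0 t hp, rfl⟩, ?_⟩
    change Ideal.Quotient.mk _ (toR1 t (toR0 t p)) = Ideal.Quotient.mk _ p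
    rw [← AlgHom.comp_apply, toR1_comp_toR0 ht, AlgHom.id_apply]
end

section
/- For all sufficiently large m, the dimension of the degree-m graded piece of R₀ / (ideal generated by the 2×2 minors of M₀) as a ℂ-vector space equals the dimension of the degree-m graded piece of R₁ / (ideal generated by the 2×2 minors of M₁); that is, the two quotient rings have the same Hilbert polynomial. -/
open MvPolynomial

section Slide

variable {ρ γ σ : Type*}

/-- A row multiset `R` and a column multiset `C` may be changed by replacing a row and a column
by another row and column with the same entry; `Slide` is the equivalence relation so generated. -/
inductive Slide (w : ρ → γ → σ) :
    Multiset ρ → Multiset γ → Multiset ρ → Multiset γ → Prop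
  | refl (R C) : Slide w R C R C
  | symm {R C R' C'} : Slide w R C R' C' → Slide w R' C' R C
  | trans {R C R' C' R'' C''} :
      Slide w R C R' C' → Slide w R' C' R'' C'' → Slide w R C R'' C''
  | move {r c r' c'} (R C) (h : w r c = w r' c') :
      Slide w (r ::ₘ R) (c ::ₘ C) (r' ::ₘ R) (c' ::ₘ C)

namespace Slide

variable {w : ρ → γ → σ} {R R' : Multiset ρ} {C C' : Multiset γ}

theorem cons_col (h : Slide w R C R' C') (d : γ) : Slide w R (d ::ₘ C) R' (d ::ₘ C') := by
  induction h with
  | refl => exact .refl _ _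
  | symm _ ih => exact ih.symm
  | trans _ _ ih₁ ih₂ => exact ih₁.trans ih₂
  | move R C h => simpa only [Multiset.cons_swap d] using Slide.move R (d ::ₘ C) h

theorem card_eq (h : Slide w R C R' C') : R.card = R'.card ∧ C.card = C'.card := by
  induction h with
  | refl => exact ⟨rfl, rfl⟩
  | symm _ ih => exact ⟨ih.1.symm, ih.2.symm⟩
  | trans _ _ ih₁ ih₂ => exact ⟨ih₁.1.trans ih₂.1, ih₁.2.trans ih₂.2⟩
  | move => simp

end Slide

/-- Total weight of a row multiset and a column multiset. -/
def weight {N : Type*} [AddCommMonoid N] (φ : ρ → N) (χ : γ → N)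
    (R : Multiset ρ) (C : Multiset γ) : N :=
  (R.map φ).sum + (C.map χ).sum

theorem weight_cons_right {N : Type*} [AddCommMonoid N] (φ : ρ → N) (χ : γ → N)
    (R : Multiset ρ) (c : γ) (C : Multiset γ) :
    weight φ χ R (c ::ₘ C) = χ c + weight φ χ R C := by
  simp only [weight, Multiset.map_cons, Multiset.sum_cons]
  exact add_left_comm _ _ _

theorem weight_cons_left {N : Type*} [AddCommMonoid N] (φ : ρ → N) (χ : γ → N)
    (r : ρ) (R : Multiset ρ) (C : Multiset γ) :
    weight φ χ (r ::ₘ R) C = φ r + weight φ χ R C := by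
  simp only [weight, Multiset.map_cons, Multiset.sum_cons, add_assoc]

theorem Slide.weight_eq {N : Type*} [AddCommMonoid N] {w : ρ → γ → σ} {L : σ → N} {φ : ρ → N}
    {χ : γ → N} (hL : ∀ r c, L (w r c) = φ r + χ c) {R R' : Multiset ρ} {C C' : Multiset γ}
    (h : Slide w R C R' C') : weight φ χ R C = weight φ χ R' C' := by
  induction h with
  | refl => rfl
  | symm _ ih => exact ih.symm
  | trans _ _ ih₁ ih₂ => exact ih₁.trans ih₂
  | move R C h =>
    simp only [weight_cons_right, weight_cons_left]
    rw [← add_assoc, ← add_assoc, add_comm (χ _), add_comm (χ _), ← hL, ← hL, h]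

/-- Rows and columns of the same weight are connected by slides, provided that from any two
nonempty states of the same weight one can reach states with a common column. -/
theorem slide_of_weight_eq {N : Type*} [AddCancelCommMonoid N] {w : ρ → γ → σ} {L : σ → N}
    {φ : ρ → N} {χ : γ → N} (hL : ∀ r c, L (w r c) = φ r + χ c)
    (base : ∀ R R' : Multiset ρ, (R.map φ).sum = (R'.map φ).sum → R = R')
    (step : ∀ R C R' C', R ≠ 0 → R' ≠ 0 → C ≠ 0 → C' ≠ 0 → weight φ χ R C = weight φ χ R' C' →
      ∃ c R₁ C₁ R₁' C₁', Slide w R C R₁ (c ::ₘ C₁) ∧ Slide w R' C' R₁' (c ::ₘ C₁'))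
    (n : ℕ) (R R' : Multiset ρ) (C C' : Multiset γ) (hR : R ≠ 0) (hR' : R' ≠ 0)
    (hC : C.card = n) (hC' : C'.card = n)
    (h : weight φ χ R C = weight φ χ R' C') : Slide w R C R' C' := by
  induction n generalizing R R' C C' with
  | zero =>
    rw [Multiset.card_eq_zero] at hC hC'
    subst hC hC'
    simp only [weight, Multiset.map_zero, Multiset.sum_zero, add_zero] at h
    rw [base R R' h]
    exact .refl _ _
  | succ n ih =>
    obtain ⟨c, R₁, C₁, R₁', C₁', s, s'⟩ := step R C R' C' hR hR'
      (by rintro rfl; simp at hC) (by rintro rfl; simp at hC') h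
    have hs := s.card_eq
    have hs' := s'.card_eq
    rw [← Multiset.card_pos] at hR hR'
    rw [s.weight_eq hL, s'.weight_eq hL, weight_cons_right, weight_cons_right,
      add_right_inj] at h
    simp only [Multiset.card_cons] at hs hs'
    refine s.trans (((ih R₁ R₁' C₁ C₁' ?_ ?_ (by omega) (by omega) h).cons_col c).trans s'.symm)
    · rw [← Multiset.card_pos]; omega
    · rw [← Multiset.card_pos]; omega

theorem exists_pairing (R : Multiset ρ) (C : Multiset γ) (h : R.card = C.card) :
    ∃ P : Multiset (ρ × γ), P.map Prod.fst = R ∧ P.map Prod.snd = C := by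
  induction R using Multiset.induction generalizing C with
  | empty => exact ⟨0, by simp, by simpa [eq_comm] using h⟩
  | cons r R ih =>
    obtain ⟨c, C', rfl⟩ : ∃ c C', C = c ::ₘ C' := by
      obtain ⟨c, hc⟩ := Multiset.card_pos_iff_exists_mem.1 (by simp at h; omega : 0 < C.card)
      exact ⟨c, Multiset.exists_cons_of_mem hc⟩
    obtain ⟨P, h₁, h₂⟩ := ih C' (by simpa using h)
    exact ⟨(r, c) ::ₘ P, by simp [h₁], by simp [h₂]⟩

variable {A : Type*} [CommMonoid A]

theorem prod_pairing_eq {y : ρ → γ → A} (hy : ∀ r r' c c', y r c * y r' c' = y r c' * y r' c)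
    (P P' : Multiset (ρ × γ)) (h₁ : P.map Prod.fst = P'.map Prod.fst)
    (h₂ : P.map Prod.snd = P'.map Prod.snd) :
    (P.map fun p => y p.1 p.2).prod = (P'.map fun p => y p.1 p.2).prod := by
  induction P using Multiset.induction generalizing P' with
  | empty =>
    have : P' = 0 := by simpa [eq_comm] using h₁
    rw [this]
  | cons p Q ih =>
    obtain ⟨r, c⟩ := p
    have hr : r ∈ P'.map Prod.fst := by simp [← h₁]
    have hc : c ∈ P'.map Prod.snd := by simp [← h₂]
    obtain ⟨⟨r₀, c'⟩, hr', rfl⟩ := Multiset.mem_map.1 hr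
    obtain ⟨⟨r', c₀⟩, hc', rfl⟩ := Multiset.mem_map.1 hc
    obtain ⟨P₁, rfl⟩ := Multiset.exists_cons_of_mem hr'
    simp only [Multiset.map_cons, Multiset.cons_inj_right, Multiset.prod_cons] at h₁ h₂ hc' ⊢
    rcases Multiset.mem_cons.1 hc' with e | hc'
    · obtain ⟨rfl, rfl⟩ := Prod.mk.inj e
      rw [ih P₁ h₁ ((Multiset.cons_inj_right _).1 h₂)]
    · obtain ⟨P₂, rfl⟩ := Multiset.exists_cons_of_mem hc'
      rw [ih ((r', c') ::ₘ P₂) (by simpa using h₁)]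
      · simp only [Multiset.map_cons, Multiset.prod_cons, ← mul_assoc]
        rw [hy]
      · rw [Multiset.map_cons, Multiset.cons_swap, Multiset.cons_inj_right] at h₂
        simpa using h₂

theorem Slide.prod_pairing_eq {w : ρ → γ → σ} {Y : σ → A}
    (hY : ∀ r r' c c', Y (w r c) * Y (w r' c') = Y (w r c') * Y (w r' c))
    {R R' : Multiset ρ} {C C' : Multiset γ} (h : Slide w R C R' C') (hRC : R.card = C.card)
    (P P' : Multiset (ρ × γ)) (h₁ : P.map Prod.fst = R) (h₂ : P.map Prod.snd = C)
    (h₁' : P'.map Prod.fst = R') (h₂' : P'.map Prod.snd = C') :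
    (P.map fun p => Y (w p.1 p.2)).prod = (P'.map fun p => Y (w p.1 p.2)).prod := by
  induction h generalizing P P' with
  | refl => exact _root_.prod_pairing_eq hY P P' (h₁.trans h₁'.symm) (h₂.trans h₂'.symm)
  | symm h ih =>
    have := h.card_eq
    exact (ih (by omega) P' P h₁' h₂' h₁ h₂).symm
  | @trans R C R' C' _ _ h h' ih₁ ih₂ =>
    have := h.card_eq
    obtain ⟨Q, hQ₁, hQ₂⟩ := exists_pairing R' C' (by omega)
    exact (ih₁ hRC P Q h₁ h₂ hQ₁ hQ₂).trans (ih₂ (by omega) Q P' hQ₁ hQ₂ h₁' h₂')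
  | @move r c r' c' R C h =>
    obtain ⟨Q, rfl, rfl⟩ := exists_pairing R C (by simpa using hRC)
    rw [_root_.prod_pairing_eq hY P ((r, c) ::ₘ Q) (by simpa using h₁) (by simpa using h₂),
      _root_.prod_pairing_eq hY P' ((r', c') ::ₘ Q) (by simpa using h₁') (by simpa using h₂')]
    simp [h]

theorem prod_eq_of_sum_eq {N : Type*} [AddCommMonoid N] {w : ρ → γ → σ} {Y : σ → A}
    (hY : ∀ r r' c c', Y (w r c) * Y (w r' c') = Y (w r c') * Y (w r' c))
    (hw : ∀ v, ∃ r c, w r c = v) {L : σ → N} {φ : ρ → N} {χ : γ → N}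
    (hL : ∀ r c, L (w r c) = φ r + χ c)
    (conn : ∀ (R R' : Multiset ρ) (C C' : Multiset γ), R ≠ 0 → R' ≠ 0 → C.card = C'.card →
      weight φ χ R C = weight φ χ R' C' → Slide w R C R' C')
    (s s' : Multiset σ) (hcard : s.card = s'.card) (hs : (s.map L).sum = (s'.map L).sum) :
    (s.map Y).prod = (s'.map Y).prod := by
  have lift : ∀ s : Multiset σ, ∃ P : Multiset (ρ × γ), P.map (fun p => w p.1 p.2) = s := by
    intro s
    choose f g hfg using hw
    exact ⟨s.map fun v => (f v, g v), by simp [hfg]⟩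
  obtain ⟨P, rfl⟩ := lift s
  obtain ⟨P', rfl⟩ := lift s'
  simp only [Multiset.card_map] at hcard
  rcases eq_or_ne P 0 with rfl | hP
  · rw [show P' = 0 by simpa [eq_comm] using hcard]
  have hP' : P' ≠ 0 := by
    rw [← Multiset.card_pos] at hP ⊢
    omega
  simp only [Multiset.map_map, Function.comp_def] at hs ⊢
  refine (conn (P.map Prod.fst) (P'.map Prod.fst) (P.map Prod.snd) (P'.map Prod.snd)
    (by simpa using hP) (by simpa using hP') (by simpa using hcard) ?_).prod_pairing_eq hY
    (by simp) P P' rfl rfl rfl rfl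
  simpa only [weight, Multiset.map_map, Function.comp_def, hL, Multiset.sum_map_add] using hs

end Slide

/-- The weights of the monomials of degree `m` when the variable `v` has weight `L v`. -/
def weightSet {σ N : Type*} [AddCommMonoid N] (L : σ → N) (m : ℕ) : Set N :=
  {n | ∃ s : Multiset σ, s.card = m ∧ (s.map L).sum = n}

theorem finite_weightSet {σ N : Type*} [Finite σ] [AddCommMonoid N] (L : σ → N) (m : ℕ) :
    (weightSet L m).Finite := by
  classical
  have := Fintype.ofFinite σ
  refine (Set.finite_range fun s : Sym σ m => ((s : Multiset σ).map L).sum).subset ?_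
  rintro _ ⟨s, hs, rfl⟩
  exact ⟨⟨s, hs⟩, rfl⟩

theorem monomial_toFinsupp {σ K : Type*} [DecidableEq σ] [CommSemiring K] (s : Multiset σ) :
    monomial (Multiset.toFinsupp s) (1 : K) = (s.map X).prod := by
  induction s using Multiset.induction with
  | empty => simp
  | cons v s ih =>
    rw [← Multiset.singleton_add, map_add, Multiset.map_add, Multiset.prod_add, ← ih,
      Multiset.toFinsupp_singleton, Multiset.map_singleton, Multiset.prod_singleton, X,
      monomial_mul, one_mul]

theorem map_homogeneousSubmodule_eq_span {σ K B : Type*} [Field K] [CommRing B] [Algebra K B]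
    (f : MvPolynomial σ K →ₐ[K] B) (m : ℕ) :
    Submodule.map f.toLinearMap (homogeneousSubmodule σ K m) =
      Submodule.span K {b | ∃ s : Multiset σ, s.card = m ∧ (s.map fun v => f (X v)).prod = b} := by
  classical
  apply le_antisymm
  · rintro _ ⟨p, hp, rfl⟩
    rw [p.as_sum, map_sum]
    refine Submodule.sum_mem _ fun u hu => ?_
    have hdeg := hp (mem_support_iff.1 hu)
    rw [← mul_one (coeff u p), ← smul_eq_mul, ← smul_monomial, map_smul]
    refine Submodule.smul_mem _ _ (Submodule.subset_span ⟨Finsupp.toMultiset u, ?_, ?_⟩)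
    · rw [Finsupp.card_toMultiset, ← hdeg]
      simp [Finsupp.weight_apply, Finsupp.sum]
    · rw [← Finsupp.toMultiset_toFinsupp u, monomial_toFinsupp, Finsupp.toMultiset_toFinsupp]
      simp [map_multiset_prod]
  · rw [Submodule.span_le]
    rintro _ ⟨s, rfl, rfl⟩
    refine ⟨(s.map X).prod, ?_, by simp [map_multiset_prod]⟩
    induction s using Multiset.induction with
    | empty => exact isHomogeneous_one σ K
    | cons v s ih =>
      rw [Multiset.map_cons, Multiset.prod_cons, Multiset.card_cons, add_comm]
      exact (isHomogeneous_X K v).mul ih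

/-- If an ideal `I` is contained in the kernel of a monomial map with weights `L`, and monomials of
the same degree and weight agree modulo `I`, then the degree-`m` piece of the quotient has dimension
the number of weights in degree `m`. -/
theorem finrank_map_homogeneousSubmodule {σ K N : Type*} [Finite σ] [Field K] [AddCommMonoid N]
    (I : Ideal (MvPolynomial σ K)) (L : σ → N)
    (hI : ∀ p ∈ I, aeval (fun v => AddMonoidAlgebra.single (L v) (1 : K)) p = 0)
    (hconn : ∀ s s' : Multiset σ, s.card = s'.card → (s.map L).sum = (s'.map L).sum →
      (s.map fun v => Ideal.Quotient.mkₐ K I (X v)).prod =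
        (s'.map fun v => Ideal.Quotient.mkₐ K I (X v)).prod) (m : ℕ) :
    Module.finrank K (Submodule.map (Ideal.Quotient.mkₐ K I).toLinearMap
      (homogeneousSubmodule σ K m)) = (weightSet L m).ncard := by
  rw [map_homogeneousSubmodule_eq_span]
  have := (finite_weightSet L m).fintype
  choose s hs hsum using fun n : weightSet L m => n.2
  have hset : {b | ∃ t : Multiset σ, t.card = m ∧
      (t.map fun v => Ideal.Quotient.mkₐ K I (X v)).prod = b} =
      Set.range fun n => ((s n).map fun v => Ideal.Quotient.mkₐ K I (X v)).prod := by
    ext b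
    constructor
    · rintro ⟨t, ht, rfl⟩
      refine ⟨⟨_, t, ht, rfl⟩, hconn _ _ ?_ ?_⟩
      · rw [hs, ht]
      · rw [hsum]
    · rintro ⟨n, rfl⟩
      exact ⟨s n, hs n, rfl⟩
  rw [hset, finrank_span_eq_card, ← Nat.card_eq_fintype_card]
  · rfl
  let f := Ideal.Quotient.liftₐ I (aeval fun v => AddMonoidAlgebra.single (L v) (1 : K)) hI
  have hf : ∀ v, f (Ideal.Quotient.mkₐ K I (X v)) = AddMonoidAlgebra.single (L v) 1 := by
    intro v
    exact aeval_X _ _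
  have hprod : ∀ t : Multiset σ, (t.map fun v => AddMonoidAlgebra.single (L v) (1 : K)).prod =
      AddMonoidAlgebra.single (t.map L).sum 1 := by
    intro t
    induction t using Multiset.induction with
    | empty => simp [AddMonoidAlgebra.one_def]
    | cons v t ih => simp [ih, AddMonoidAlgebra.single_mul_single]
  refine LinearIndependent.of_comp f.toLinearMap ?_
  have : (⇑f.toLinearMap ∘ fun n => ((s n).map fun v => Ideal.Quotient.mkₐ K I (X v)).prod) =
      fun n : weightSet L m => AddMonoidAlgebra.single (n : N) (1 : K) := by
    funext n
    simp only [Function.comp_apply, AlgHom.toLinearMap_apply, map_multiset_prod,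
      Multiset.map_map, hf, hprod, hsum]
  rw [this]
  refine LinearIndependent.of_comp (AddMonoidAlgebra.coeffLinearEquiv K).toLinearMap ?_
  exact (Finsupp.basisSingleOne (R := K) (ι := N)).linearIndependent.comp _ Subtype.val_injective

/-- The Hilbert function of the quotient by the `2 × 2` minors of a matrix of variables `w r c`
of weights `φ r + χ c`, if slides connect all rows and columns of equal weight. -/
theorem finrank_quotient_minors2 {σ K N ρ γ ρ₀ γ₀ : Type*} [Finite σ] [Field K] [AddCommMonoid N]
    {M : Matrix ρ₀ γ₀ (MvPolynomial σ K)} {i : ρ → ρ₀} {j : γ → γ₀}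
    (hi : Function.Surjective i) (hj : Function.Surjective j) {w : ρ → γ → σ}
    (hM : ∀ r c, M (i r) (j c) = X (w r c)) (hw : ∀ v, ∃ r c, w r c = v)
    {L : σ → N} {φ : ρ → N} {χ : γ → N} (hL : ∀ r c, L (w r c) = φ r + χ c)
    (conn : ∀ (R R' : Multiset ρ) (C C' : Multiset γ), R ≠ 0 → R' ≠ 0 → C.card = C'.card →
      weight φ χ R C = weight φ χ R' C' → Slide w R C R' C') (m : ℕ) :
    Module.finrank K (Submodule.map (Ideal.Quotient.mkₐ K (minors2 M)).toLinearMap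
      (homogeneousSubmodule σ K m)) = (weightSet L m).ncard := by
  refine finrank_map_homogeneousSubmodule _ L ?_ ?_ m
  · change minors2 M ≤ RingHom.ker _
    refine Ideal.span_le.2 ?_
    rintro _ ⟨i₁, i₂, j₁, j₂, rfl⟩
    obtain ⟨r₁, rfl⟩ := hi i₁
    obtain ⟨r₂, rfl⟩ := hi i₂
    obtain ⟨c₁, rfl⟩ := hj j₁
    obtain ⟨c₂, rfl⟩ := hj j₂
    simp only [hM, SetLike.mem_coe, RingHom.mem_ker, map_sub, map_mul, aeval_X,
      AddMonoidAlgebra.single_mul_single, hL]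
    rw [add_add_add_comm, add_comm (χ c₁), add_add_add_comm, sub_self]
  · refine prod_eq_of_sum_eq ?_ hw hL conn
    intro r r' c c'
    rw [← map_mul, ← map_mul]
    refine Ideal.Quotient.eq.2 (Ideal.subset_span ⟨i r, i r', j c, j c', ?_⟩)
    simp only [hM]

/-- Weights of monomials in the `t`-variables and the `x`-variables. -/
abbrev Wt : Type := Multiset (Fin 2) × Multiset (Fin 4)

theorem mem_fst_sum_map {α β δ : Type*} {f : α → Multiset β × Multiset δ} {s : Multiset α}
    {b : β} : b ∈ (s.map f).sum.1 ↔ ∃ a ∈ s, b ∈ (f a).1 := by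
  induction s using Multiset.induction with
  | empty => simp
  | cons a s ih => simp [ih]

theorem mem_snd_sum_map {α β δ : Type*} {f : α → Multiset β × Multiset δ} {s : Multiset α}
    {d : δ} : d ∈ (s.map f).sum.2 ↔ ∃ a ∈ s, d ∈ (f a).2 := by
  induction s using Multiset.induction with
  | empty => simp
  | cons a s ih => simp [ih]

theorem mem_fst_weight {ρ γ β δ : Type*} {φ : ρ → Multiset β × Multiset δ}
    {χ : γ → Multiset β × Multiset δ} {R : Multiset ρ} {C : Multiset γ} {b : β} :
    b ∈ (weight φ χ R C).1 ↔ (∃ r ∈ R, b ∈ (φ r).1) ∨ ∃ c ∈ C, b ∈ (χ c).1 := by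
  simp only [weight, Prod.fst_add, Multiset.mem_add, mem_fst_sum_map]

theorem mem_snd_weight {ρ γ β δ : Type*} {φ : ρ → Multiset β × Multiset δ}
    {χ : γ → Multiset β × Multiset δ} {R : Multiset ρ} {C : Multiset γ} {d : δ} :
    d ∈ (weight φ χ R C).2 ↔ (∃ r ∈ R, d ∈ (φ r).2) ∨ ∃ c ∈ C, d ∈ (χ c).2 := by
  simp only [weight, Prod.snd_add, Multiset.mem_add, mem_snd_sum_map]

/-- `C` can be made to contain the column `c` by slides. -/
def Reaches {ρ γ σ : Type*} (w : ρ → γ → σ) (c : γ) (R : Multiset ρ) (C : Multiset γ) : Prop :=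
  ∃ R₁ C₁, Slide w R C R₁ (c ::ₘ C₁)

namespace Reaches

variable {ρ γ σ : Type*} {w : ρ → γ → σ} {c : γ} {R R' : Multiset ρ} {C C' : Multiset γ}

theorem of_mem (h : c ∈ C) : Reaches w c R C := by
  obtain ⟨C₁, rfl⟩ := Multiset.exists_cons_of_mem h
  exact ⟨R, C₁, .refl _ _⟩

theorem of_slide (h : Slide w R C R' C') (h' : Reaches w c R' C') : Reaches w c R C := by
  obtain ⟨R₁, C₁, h'⟩ := h'
  exact ⟨R₁, C₁, h.trans h'⟩

theorem of_eq {r r' : ρ} {c' : γ} (h : w r c' = w r' c) (hr : r ∈ R) (hc : c' ∈ C) :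
    Reaches w c R C := by
  obtain ⟨R₁, rfl⟩ := Multiset.exists_cons_of_mem hr
  obtain ⟨C₁, rfl⟩ := Multiset.exists_cons_of_mem hc
  exact ⟨_, _, .move R₁ C₁ h⟩

end Reaches

namespace SegreVeronese

/-- The entry of `M₁` in row `k` and column `(i, l)`, with product `s_i x_k x_l`. -/
def entry (k : Fin 4) (c : Fin 2 × Fin 4) : ZVar :=
  (c.1, ⟨(min k c.2, max k c.2), min_le_max⟩)

/-- The position of the column `(i, l)` in `M₁`. -/
def colIdx (c : Fin 2 × Fin 4) : Fin 8 := ⟨4 * c.1 + c.2, by omega⟩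

/-- The weight of the variable `z_{i,kl}`. -/
def varWt (v : ZVar) : Wt := ({v.1}, {v.2.1.1, v.2.1.2})

/-- The weight of the row `k`. -/
def rowWt (k : Fin 4) : Wt := (0, {k})

/-- The weight of the column `(i, l)`. -/
def colWt (c : Fin 2 × Fin 4) : Wt := ({c.1}, {c.2})

theorem colIdx_surjective : Function.Surjective colIdx := by
  intro c
  exact ⟨(⟨c / 4, by omega⟩, ⟨c % 4, by omega⟩), by ext; simp [colIdx]; omega⟩

theorem M1_apply (k : Fin 4) (c : Fin 2 × Fin 4) : M1 k (colIdx c) = X (entry k c) := by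
  obtain ⟨i, l⟩ := c
  have hl := l.isLt
  fin_cases i
  · simp [M1, colIdx, zVar, entry, Nat.mod_eq_of_lt hl]
  · simp [M1, colIdx, zVar, entry, Nat.mod_eq_of_lt hl]

theorem entry_surjective (v : ZVar) : ∃ k c, entry k c = v := by
  obtain ⟨i, ⟨⟨k, l⟩, h⟩⟩ := v
  exact ⟨k, (i, l), by simp_all [entry]⟩

theorem entry_swap (i : Fin 2) (k l : Fin 4) : entry k (i, l) = entry l (i, k) := by
  simp [entry, min_comm, max_comm]

theorem varWt_entry (k : Fin 4) (c : Fin 2 × Fin 4) :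
    varWt (entry k c) = rowWt k + colWt c := by
  obtain ⟨i, l⟩ := c
  rcases le_total k l with h | h
  · simp [varWt, entry, rowWt, colWt, h]
  · simp [varWt, entry, rowWt, colWt, h, Multiset.pair_comm l k]

theorem eq_of_sum_rowWt_eq (R R' : Multiset (Fin 4))
    (h : (R.map rowWt).sum = (R'.map rowWt).sum) : R = R' := by
  have key : ∀ R : Multiset (Fin 4), (R.map rowWt).sum.2 = R := by
    intro R
    induction R using Multiset.induction with
    | empty => rfl
    | cons k R ih => simp [ih, rowWt]
  rw [← key R, h, key]

theorem reaches_of_mem {i : Fin 2} {l : Fin 4} {R : Multiset (Fin 4)}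
    {C : Multiset (Fin 2 × Fin 4)} (hR : R ≠ 0) (hi : ∃ k, (i, k) ∈ C)
    (hl : l ∈ R ∨ ∃ j, (j, l) ∈ C) : Reaches entry (i, l) R C := by
  obtain ⟨k, hk⟩ := hi
  rcases hl with hl | ⟨j, hj⟩
  · exact .of_eq (entry_swap i l k) hl hk
  obtain ⟨r, hr⟩ := Multiset.exists_mem_of_ne_zero hR
  obtain ⟨C₁, rfl⟩ := Multiset.exists_cons_of_mem hj
  rcases Multiset.mem_cons.1 hk with e | hk
  · obtain ⟨rfl, rfl⟩ := Prod.mk.inj e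
    exact .of_mem hj
  obtain ⟨R₁, rfl⟩ := Multiset.exists_cons_of_mem hr
  refine .of_slide (.move R₁ C₁ (entry_swap j r l)) ?_
  exact .of_eq (entry_swap i l k) (by simp) (by simp [hk])

theorem slide_of_weight_eq (R R' : Multiset (Fin 4)) (C C' : Multiset (Fin 2 × Fin 4))
    (hR : R ≠ 0) (hR' : R' ≠ 0) (hC : C.card = C'.card)
    (h : weight rowWt colWt R C = weight rowWt colWt R' C') : Slide entry R C R' C' := by
  refine _root_.slide_of_weight_eq varWt_entry eq_of_sum_rowWt_eq ?_ C'.card R R' C C' hR hR' hC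
    rfl h
  intro R C R' C' hR _ _ hC' h
  obtain ⟨⟨i, l⟩, hc⟩ := Multiset.exists_mem_of_ne_zero hC'
  have hi : i ∈ (weight rowWt colWt R C).1 := by
    rw [h, mem_fst_weight]
    exact Or.inr ⟨_, hc, by simp [colWt]⟩
  have hl : l ∈ (weight rowWt colWt R C).2 := by
    rw [h, mem_snd_weight]
    exact Or.inr ⟨_, hc, by simp [colWt]⟩
  obtain ⟨R₁, C₁, s⟩ : Reaches entry (i, l) R C := by
    refine reaches_of_mem hR ?_ ?_
    · simpa [mem_fst_weight, rowWt, colWt] using hi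
    · simpa [mem_snd_weight, rowWt, colWt] using hl
  obtain ⟨R₁', C₁', s'⟩ := Reaches.of_mem (w := entry) (R := R') hc
  exact ⟨_, _, _, _, _, s, s'⟩

theorem finrank_eq (m : ℕ) :
    Module.finrank ℂ (Submodule.map (Ideal.Quotient.mkₐ ℂ (minors2 M1)).toLinearMap
      (homogeneousSubmodule ZVar ℂ m)) = (weightSet varWt m).ncard :=
  finrank_quotient_minors2 Function.surjective_id colIdx_surjective M1_apply entry_surjective
    varWt_entry slide_of_weight_eq m

theorem weightSet_varWt (m : ℕ) :
    weightSet varWt m = {T : Multiset (Fin 2) | T.card = m} ×ˢ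
      {A : Multiset (Fin 4) | A.card = 2 * m} := by
  ext ⟨T, A⟩
  constructor
  · have key : ∀ s : Multiset ZVar, (s.map varWt).sum.1.card = s.card ∧
        (s.map varWt).sum.2.card = 2 * s.card := by
      intro s
      induction s using Multiset.induction with
      | empty => simp
      | cons v s ih => simp [varWt, ih]; omega
    rintro ⟨s, rfl, h⟩
    have := key s
    rwa [h] at this
  · rintro ⟨hT, hA⟩
    change T.card = m at hT
    change A.card = 2 * m at hA
    induction m generalizing T A with
    | zero =>
      rw [Multiset.card_eq_zero.1 hT, Multiset.card_eq_zero.1 hA]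
      exact ⟨0, rfl, rfl⟩
    | succ m ih =>
      obtain ⟨i, T, rfl, hT'⟩ := Multiset.card_eq_succ_iff.1 hT
      obtain ⟨k, A, rfl, hA'⟩ := Multiset.card_eq_succ_iff.1 hA
      obtain ⟨l, A, rfl, hA''⟩ := Multiset.card_eq_succ_iff.1 hA'
      obtain ⟨s, hs, h⟩ := ih T A hT' hA''
      refine ⟨entry k (i, l) ::ₘ s, by simp [hs], ?_⟩
      rw [Multiset.map_cons, Multiset.sum_cons, h, varWt_entry]
      simp [rowWt, colWt]

theorem ncard_weightSet (m : ℕ) :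
    (weightSet varWt m).ncard = (m + 1) * (2 * m + 3).choose 3 := by
  have key : ∀ k n : ℕ, {A : Multiset (Fin k) | A.card = n}.ncard = k.multichoose n := by
    intro k n
    have := Sym.card_sym_eq_multichoose (Fin k) n
    rw [Fintype.card_fin, ← Nat.card_eq_fintype_card] at this
    exact this
  rw [weightSet_varWt, Set.ncard_prod, key, key, Nat.multichoose_two, Nat.multichoose_eq,
    show 4 + 2 * m - 1 = 2 * m + 3 by omega, Nat.choose_symm_add]

end SegreVeronese

namespace Scroll

/-- The row labels of `M₀`: `x p` is `x₂` or `x₃`, and `t i` is `t_i x₄`. -/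
inductive Row
  | x (p : Fin 2)
  | t (i : Fin 2)

/-- The column labels of `M₀`: `a` is `x₁`, `b i p` is `t_i x₂` or `t_i x₃`, and `d i j` is
`t_i t_j x₄`. -/
inductive Col
  | a
  | b (i p : Fin 2)
  | d (i j : Fin 2)

/-- The index of `x₂` or `x₃` among `x₁, x₂, x₃, x₄`. -/
def mid (p : Fin 2) : Fin 4 := p.succ.castSucc

/-- The position of a row label in `M₀`. -/
def Row.idx : Row → Fin 4
  | x p => ![0, 1] p
  | t i => ![2, 3] i

/-- The position of a column label in `M₀`. -/
def Col.idx : Col → Fin 8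
  | a => 0
  | b i p => ![![1, 2], ![3, 4]] i p
  | d i j => ![![5, 6], ![6, 7]] i j

/-- The weight of a row label. -/
def Row.wt : Row → Wt
  | x p => (0, {mid p})
  | t i => ({i}, {3})

/-- The weight of a column label. -/
def Col.wt : Col → Wt
  | a => (0, {0})
  | b i p => ({i}, {mid p})
  | d i j => ({i, j}, {3})

/-- The weight of the variable `y_w`. -/
def varWt (v : Lam) : Wt :=
  (Multiset.replicate v.1.1 0 + Multiset.replicate v.1.2.1 1, {v.1.2.2.1, v.1.2.2.2})

/-- The entries of `M₀` by position. -/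
def entryIdx (r : Fin 4) (c : Fin 8) : Lam :=
  ⟨((rowLab r).1 + (colLab c).1, (rowLab r).2.1 + (colLab c).2.1,
    min (rowLab r).2.2 (colLab c).2.2, max (rowLab r).2.2 (colLab c).2.2),
    by revert r c; decide⟩

/-- The entries of `M₀` by label. -/
def entry (r : Row) (c : Col) : Lam := entryIdx r.idx c.idx

theorem Row.idx_surjective : Function.Surjective Row.idx := by
  intro r
  fin_cases r
  exacts [⟨x 0, rfl⟩, ⟨x 1, rfl⟩, ⟨t 0, rfl⟩, ⟨t 1, rfl⟩]

theorem Col.idx_surjective : Function.Surjective Col.idx := by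
  intro c
  fin_cases c
  exacts [⟨a, rfl⟩, ⟨b 0 0, rfl⟩, ⟨b 0 1, rfl⟩, ⟨b 1 0, rfl⟩, ⟨b 1 1, rfl⟩, ⟨d 0 0, rfl⟩,
    ⟨d 0 1, rfl⟩, ⟨d 1 1, rfl⟩]

theorem M0_apply (r : Row) (c : Col) : M0 r.idx c.idx = X (entry r c) :=
  dif_pos (entryIdx r.idx c.idx).2

theorem entry_surjective (v : Lam) : ∃ r c, entry r c = v := by
  have key : ∀ (i j : Fin 4) (m n : Fin 4), m ≤ n ∧ (i : ℕ) + j + 1 = av m + av n →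
      ∃ r c, (entryIdx r c).1 = (↑i, ↑j, m, n) := by decide
  have hav : ∀ m, av m ≤ 2 := by decide
  obtain ⟨⟨i, j, m, n⟩, h⟩ := v
  have hm := hav m
  have hn := hav n
  obtain ⟨r, c, hrc⟩ := key ⟨i, by simp at h; omega⟩ ⟨j, by simp at h; omega⟩ m n h
  obtain ⟨r, rfl⟩ := Row.idx_surjective r
  obtain ⟨c, rfl⟩ := Col.idx_surjective c
  exact ⟨r, c, Subtype.ext hrc⟩

theorem varWt_entry (r : Row) (c : Col) : varWt (entry r c) = r.wt + c.wt := by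
  cases r with
  | x p =>
    cases c with
    | a => revert p; decide
    | b i q => revert p i q; decide
    | d i j => revert p i j; decide
  | t k =>
    cases c with
    | a => revert k; decide
    | b i q => revert k i q; decide
    | d i j => revert k i j; decide

theorem entry_x_b (p i q : Fin 2) : entry (.x p) (.b i q) = entry (.x q) (.b i p) := by
  revert p i q; decide

theorem entry_t_b (k i p : Fin 2) : entry (.t k) (.b i p) = entry (.t i) (.b k p) := by
  revert k i p; decide

theorem entry_x_d (p i j : Fin 2) : entry (.x p) (.d i j) = entry (.t j) (.b i p) := by
  revert p i j; decide

theorem entry_t_d (k i j : Fin 2) : entry (.t k) (.d i j) = entry (.t i) (.d k j) := by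
  revert k i j; decide

theorem entry_d_comm (r : Row) (i j : Fin 2) : entry r (.d i j) = entry r (.d j i) := by
  cases r with
  | x p => revert p i j; decide
  | t k => revert k i j; decide

theorem mid_injective : Function.Injective mid := by decide

theorem mid_ne_zero (p : Fin 2) : mid p ≠ 0 := by revert p; decide

theorem mid_ne_three (p : Fin 2) : mid p ≠ 3 := by revert p; decide

section Weight

variable {R : Multiset Row} {C : Multiset Col}

theorem mem_fst_weight_iff {i : Fin 2} : i ∈ (weight Row.wt Col.wt R C).1 ↔
    .t i ∈ R ∨ (∃ q, .b i q ∈ C) ∨ (∃ j, .d i j ∈ C) ∨ ∃ j, .d j i ∈ C := by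
  rw [mem_fst_weight]
  constructor
  · rintro (⟨r | r, hr, h⟩ | ⟨_ | _ | _, hc, h⟩) <;> simp [Row.wt, Col.wt] at h
    · exact .inl (h ▸ hr)
    · exact .inr (.inl ⟨_, h ▸ hc⟩)
    · rcases h with rfl | rfl
      · exact .inr (.inr (.inl ⟨_, hc⟩))
      · exact .inr (.inr (.inr ⟨_, hc⟩))
  · rintro (h | ⟨q, h⟩ | ⟨j, h⟩ | ⟨j, h⟩)
    · exact .inl ⟨_, h, by simp [Row.wt]⟩
    all_goals exact .inr ⟨_, h, by simp [Col.wt]⟩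

theorem mid_mem_snd_weight_iff {p : Fin 2} : mid p ∈ (weight Row.wt Col.wt R C).2 ↔
    .x p ∈ R ∨ ∃ j, .b j p ∈ C := by
  rw [mem_snd_weight]
  constructor
  · rintro (⟨r | r, hr, h⟩ | ⟨_ | _ | _, hc, h⟩) <;>
      simp [Row.wt, Col.wt, mid_ne_zero, mid_ne_three, mid_injective.eq_iff] at h
    · exact .inl (h ▸ hr)
    · exact .inr ⟨_, h ▸ hc⟩
  · rintro (h | ⟨q, h⟩)
    · exact .inl ⟨_, h, by simp [Row.wt]⟩
    · exact .inr ⟨_, h, by simp [Col.wt]⟩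

theorem zero_mem_snd_weight_iff : 0 ∈ (weight Row.wt Col.wt R C).2 ↔ .a ∈ C := by
  rw [mem_snd_weight]
  constructor
  · rintro (⟨r | r, hr, h⟩ | ⟨_ | _ | _, hc, h⟩) <;>
      simp [Row.wt, Col.wt, (mid_ne_zero _).symm] at h
    exact hc
  · exact fun h => .inr ⟨_, h, by simp [Col.wt]⟩

end Weight

theorem eq_of_sum_wt_eq (R R' : Multiset Row)
    (h : (R.map Row.wt).sum = (R'.map Row.wt).sum) : R = R' := by
  have hx : ∀ (S : Multiset Row) (p : Fin 2), mid p ∈ (S.map Row.wt).sum.2 ↔ .x p ∈ S := by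
    intro S p
    simpa [weight] using mid_mem_snd_weight_iff (R := S) (C := 0) (p := p)
  have ht : ∀ (S : Multiset Row) (i : Fin 2), i ∈ (S.map Row.wt).sum.1 ↔ .t i ∈ S := by
    intro S i
    simpa [weight] using mem_fst_weight_iff (R := S) (C := 0) (i := i)
  induction R using Multiset.induction generalizing R' with
  | empty =>
    refine (Multiset.eq_zero_of_forall_notMem fun r hr => ?_).symm
    cases r with
    | x p => simp [← hx R', ← h] at hr
    | t i => simp [← ht R', ← h] at hr
  | cons r R ih =>
    have hr : r ∈ R' := by
      cases r with
      | x p => simp [← hx R', ← h, Row.wt]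
      | t i => simp [← ht R', ← h, Row.wt]
    obtain ⟨R'', rfl⟩ := Multiset.exists_cons_of_mem hr
    rw [ih R'' (by simpa using h)]

section Reach

variable {R : Multiset Row} {C : Multiset Col}

theorem reaches_b_of_x {p i : Fin 2} (hx : .x p ∈ R) (hC : C ≠ 0) (ha : .a ∉ C)
    (ht : .t i ∈ R ∨ (∃ q, .b i q ∈ C) ∨ (∃ j, .d i j ∈ C) ∨ ∃ j, .d j i ∈ C) :
    Reaches entry (.b i p) R C := by
  rcases ht with ht | ⟨q, hb⟩ | ⟨j, hd⟩ | ⟨j, hd⟩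
  · obtain ⟨c, hc⟩ := Multiset.exists_mem_of_ne_zero hC
    obtain ⟨C₁, rfl⟩ := Multiset.exists_cons_of_mem hc
    obtain ⟨R₁, rfl⟩ := Multiset.exists_cons_of_mem ht
    replace hx : Row.x p ∈ R₁ := by simpa using hx
    cases c with
    | a => exact absurd hc ha
    | b j q =>
      exact .of_slide (.move R₁ C₁ (entry_t_b i j q))
        (.of_eq (entry_x_b p i q) (by simp [hx]) (by simp))
    | d j k =>
      exact .of_slide (.move R₁ C₁ (entry_t_d i j k))
        (.of_eq (entry_x_d p i k) (by simp [hx]) (by simp))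
  · exact .of_eq (entry_x_b p i q) hx hb
  · exact .of_eq (entry_x_d p i j) hx hd
  · exact .of_eq ((entry_d_comm _ _ _).trans (entry_x_d p i j)) hx hd

theorem reaches_b {p i : Fin 2} (hR : R ≠ 0) (hC : C ≠ 0) (ha : .a ∉ C)
    (hx : .x p ∈ R ∨ ∃ j, .b j p ∈ C)
    (ht : .t i ∈ R ∨ (∃ q, .b i q ∈ C) ∨ (∃ j, .d i j ∈ C) ∨ ∃ j, .d j i ∈ C) :
    Reaches entry (.b i p) R C := by
  rcases hx with hx | ⟨j, hb⟩
  · exact reaches_b_of_x hx hC ha ht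
  by_cases hti : .t i ∈ R
  · exact .of_eq (entry_t_b i j p) hti hb
  replace ht := ht.resolve_left hti
  by_cases hip : .b i p ∈ C
  · exact .of_mem hip
  obtain ⟨C₁, rfl⟩ := Multiset.exists_cons_of_mem hb
  obtain ⟨r, hr⟩ := Multiset.exists_mem_of_ne_zero hR
  obtain ⟨R₁, rfl⟩ := Multiset.exists_cons_of_mem hr
  have hj : i ≠ j := by
    rintro rfl
    simp at hip
  cases r with
  | x s =>
    refine .of_slide (.move R₁ C₁ (entry_x_b s j p)) (reaches_b_of_x (by simp) (by simp) ?_ ?_)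
    · simpa using ha
    · simp only [Multiset.mem_cons, Col.b.injEq, hj, false_and, false_or, reduceCtorEq] at ht ⊢
      exact .inr ht
  | t k =>
    refine .of_slide (.move R₁ C₁ (entry_x_d p j k).symm)
      (reaches_b_of_x (by simp) (by simp) ?_ ?_)
    · simpa using ha
    · simp only [Multiset.mem_cons, Col.b.injEq, hj, false_and, false_or, reduceCtorEq] at ht ⊢
      rcases ht with ⟨q, h⟩ | ⟨j, h⟩ | ⟨j, h⟩
      · exact .inr (.inl ⟨q, h⟩)
      · exact .inr (.inr (.inl ⟨j, .inr h⟩))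
      · exact .inr (.inr (.inr ⟨j, .inr h⟩))

theorem reaches_d_of_mem {i j k : Fin 2} (hb : ∀ i p, ¬ Reaches entry (.b i p) R C) (hR : R ≠ 0)
    (hd : .d i k ∈ C) {R' : Multiset Row} {C' : Multiset Col}
    (h : weight Row.wt Col.wt R C = weight Row.wt Col.wt R' C') (hd' : .d i j ∈ C') :
    Reaches entry (.d i j) R C := by
  obtain ⟨C₁, rfl⟩ := Multiset.exists_cons_of_mem hd
  obtain ⟨C₁', rfl⟩ := Multiset.exists_cons_of_mem hd'
  have hj : j ∈ k ::ₘ (weight Row.wt Col.wt R C₁).1 := by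
    have h₁ := congrArg Prod.fst h
    simp only [weight_cons_right, Col.wt, Prod.fst_add, Multiset.insert_eq_cons,
      Multiset.cons_add, Multiset.singleton_add, Multiset.cons_inj_right] at h₁
    simp [h₁]
  rcases Multiset.mem_cons.1 hj with rfl | hj
  · exact .of_mem (by simp)
  have move : ∀ S : Multiset Row, .t j ∈ S → ∀ D, Reaches entry (.d i j) S (.d i k ::ₘ D) :=
    fun S hS D => .of_eq ((entry_d_comm _ _ _).trans ((entry_t_d j k i).trans
      (entry_d_comm _ _ _))) hS (by simp)
  obtain ⟨r, hr⟩ := Multiset.exists_mem_of_ne_zero hR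
  cases r with
  | x p => exact absurd (.of_eq (entry_x_d p i k) hr hd) (hb i p)
  | t s =>
    obtain ⟨R₁, rfl⟩ := Multiset.exists_cons_of_mem hr
    have via : ∀ l, .d j l ∈ C₁ ∨ .d l j ∈ C₁ → Reaches entry (.d i j) (.t s ::ₘ R₁)
        (.d i k ::ₘ C₁) := by
      rintro l (hl | hl)
      · obtain ⟨C₂, rfl⟩ := Multiset.exists_cons_of_mem hl
        rw [Multiset.cons_swap]
        refine .of_slide (.move R₁ _ (entry_t_d s j l)) ?_
        rw [Multiset.cons_swap]
        exact move _ (by simp) _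
      · obtain ⟨C₂, rfl⟩ := Multiset.exists_cons_of_mem hl
        rw [Multiset.cons_swap]
        refine .of_slide (.move R₁ _ ((entry_d_comm _ _ _).trans (entry_t_d s j l))) ?_
        rw [Multiset.cons_swap]
        exact move _ (by simp) _
    rcases mem_fst_weight_iff.1 hj with ht | ⟨q, hq⟩ | ⟨l, hl⟩ | ⟨l, hl⟩
    · exact move _ ht _
    · exact absurd (.of_mem (by simp [hq])) (hb j q)
    · exact via l (.inl hl)
    · exact via l (.inr hl)

theorem reaches_d {i j : Fin 2} (hb : ∀ i p, ¬ Reaches entry (.b i p) R C) (hR : R ≠ 0)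
    (hC : C ≠ 0) (ha : .a ∉ C) {R' : Multiset Row} {C' : Multiset Col}
    (h : weight Row.wt Col.wt R C = weight Row.wt Col.wt R' C') (hd' : .d i j ∈ C') :
    Reaches entry (.d i j) R C := by
  suffices ∃ k, Reaches entry (.d i k) R C by
    obtain ⟨k, R₁, C₁, s⟩ := this
    refine .of_slide s (reaches_d_of_mem (fun i p hr => hb i p (.of_slide s hr)) ?_
      (Multiset.mem_cons_self _ _)
      ((s.weight_eq varWt_entry).symm.trans h) hd')
    rw [← Multiset.card_pos, ← s.card_eq.1, Multiset.card_pos]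
    exact hR
  have hi : i ∈ (weight Row.wt Col.wt R C).1 := by
    rw [h, mem_fst_weight_iff]
    exact .inr (.inr (.inl ⟨j, hd'⟩))
  rcases mem_fst_weight_iff.1 hi with ht | ⟨q, hq⟩ | ⟨l, hl⟩ | ⟨l, hl⟩
  · obtain ⟨c, hc⟩ := Multiset.exists_mem_of_ne_zero hC
    cases c with
    | a => exact absurd hc ha
    | b k q => exact absurd (.of_mem hc) (hb k q)
    | d k l => exact ⟨l, .of_eq (entry_t_d i k l) ht hc⟩
  · exact absurd (.of_mem hq) (hb i q)
  · exact ⟨l, .of_mem hl⟩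
  · obtain ⟨r, hr⟩ := Multiset.exists_mem_of_ne_zero hR
    exact ⟨l, .of_eq (entry_d_comm r l i) hr hl⟩

theorem reaches_b_of_weight_eq {i p : Fin 2} {R' : Multiset Row} {C' : Multiset Col}
    (hb : Reaches entry (.b i p) R C) (hR' : R' ≠ 0) (hC' : C' ≠ 0) (ha' : .a ∉ C')
    (h : weight Row.wt Col.wt R C = weight Row.wt Col.wt R' C') :
    Reaches entry (.b i p) R' C' := by
  obtain ⟨R₁, C₁, s⟩ := hb
  rw [s.weight_eq varWt_entry] at h
  refine reaches_b hR' hC' ha' ?_ ?_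
  · rw [← mid_mem_snd_weight_iff, ← h, mid_mem_snd_weight_iff]
    simp
  · rw [← mem_fst_weight_iff, ← h, mem_fst_weight_iff]
    simp

end Reach

theorem slide_of_weight_eq (R R' : Multiset Row) (C C' : Multiset Col)
    (hR : R ≠ 0) (hR' : R' ≠ 0) (hC : C.card = C'.card)
    (h : weight Row.wt Col.wt R C = weight Row.wt Col.wt R' C') : Slide entry R C R' C' := by
  refine _root_.slide_of_weight_eq varWt_entry eq_of_sum_wt_eq ?_ C'.card R R' C C' hR hR' hC
    rfl h
  intro R C R' C' hR hR' hC hC' h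
  suffices ∃ c, Reaches entry c R C ∧ Reaches entry c R' C' by
    obtain ⟨c, ⟨R₁, C₁, s⟩, R₁', C₁', s'⟩ := this
    exact ⟨c, R₁, C₁, R₁', C₁', s, s'⟩
  have haa : Col.a ∈ C ↔ Col.a ∈ C' := by
    rw [← zero_mem_snd_weight_iff (R := R), h, zero_mem_snd_weight_iff]
  by_cases ha' : .a ∈ C'
  · exact ⟨.a, .of_mem (haa.2 ha'), .of_mem ha'⟩
  have ha : .a ∉ C := mt haa.1 ha'
  by_cases hb : ∃ i p, Reaches entry (.b i p) R C
  · obtain ⟨i, p, hb⟩ := hb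
    exact ⟨_, hb, reaches_b_of_weight_eq hb hR' hC' ha' h⟩
  by_cases hb' : ∃ i p, Reaches entry (.b i p) R' C'
  · obtain ⟨i, p, hb'⟩ := hb'
    exact ⟨_, reaches_b_of_weight_eq hb' hR hC ha h.symm, hb'⟩
  push Not at hb hb'
  obtain ⟨c, hc⟩ := Multiset.exists_mem_of_ne_zero hC'
  cases c with
  | a => exact absurd hc ha'
  | b i p => exact absurd (.of_mem hc) (hb' i p)
  | d i j => exact ⟨_, reaches_d hb hR hC ha h hc, .of_mem hc⟩

theorem finrank_eq (m : ℕ) :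
    Module.finrank ℂ (Submodule.map (Ideal.Quotient.mkₐ ℂ (minors2 M0)).toLinearMap
      (homogeneousSubmodule Lam ℂ m)) = (weightSet varWt m).ncard := by
  have : Finite Lam := by
    refine Finite.of_surjective (fun p : Fin 4 × Fin 8 => entryIdx p.1 p.2) fun v => ?_
    obtain ⟨r, c, h⟩ := entry_surjective v
    exact ⟨(r.idx, c.idx), h⟩
  exact finrank_quotient_minors2 Row.idx_surjective Col.idx_surjective M0_apply entry_surjective
    varWt_entry slide_of_weight_eq m

theorem varWt_mem (v : Lam) : (varWt v).2.card = 2 ∧ (varWt v).2.count 0 ≤ 1 ∧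
    (varWt v).1.card + (varWt v).2.count 0 = 1 + (varWt v).2.count 3 := by
  have key : ∀ m n : Fin 4, 0 < av m + av n → ({m, n} : Multiset (Fin 4)).count 0 ≤ 1 ∧
      av m + av n + ({m, n} : Multiset (Fin 4)).count 0 =
        2 + ({m, n} : Multiset (Fin 4)).count 3 := by decide
  obtain ⟨⟨i, j, m, n⟩, h⟩ := v
  simp only at h
  have := key m n (by omega)
  refine ⟨rfl, this.1, ?_⟩
  simp only [varWt, Multiset.card_add, Multiset.card_replicate]
  omega

theorem exists_varWt_eq (m n : Fin 4) (T : Multiset (Fin 2))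
    (hT : T.card + 1 = av m + av n) : ∃ v, varWt v = (T, {m, n}) := by
  have hT' : Multiset.replicate (T.count 0) 0 + Multiset.replicate (T.count 1) 1 = T := by
    ext i
    fin_cases i <;> simp [Multiset.count_replicate]
  have hcard : T.count 0 + T.count 1 = T.card := by
    simpa using congrArg Multiset.card hT'
  rcases le_total m n with hmn | hmn
  · exact ⟨⟨(T.count 0, T.count 1, m, n), hmn, by simp only; omega⟩, Prod.ext hT' rfl⟩
  · exact ⟨⟨(T.count 0, T.count 1, n, m), hmn, by simp only; omega⟩,
      Prod.ext hT' (Multiset.pair_comm _ _)⟩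

theorem exists_pair {m : ℕ} {A : Multiset (Fin 4)} (hA : A.card = 2 * (m + 1))
    (h0 : A.count 0 ≤ m + 1) : ∃ k l B, A = k ::ₘ l ::ₘ B ∧ l ≠ 0 ∧ B.count 0 ≤ m := by
  by_cases h : 0 ∈ A
  · obtain ⟨A, rfl⟩ := Multiset.exists_cons_of_mem h
    rw [Multiset.count_cons_self] at h0
    rw [Multiset.card_cons] at hA
    obtain ⟨l, hl, hl0⟩ : ∃ l ∈ A, l ≠ 0 := by
      by_contra! hall
      rw [Multiset.count_eq_card.2 fun x hx => (hall x hx).symm] at h0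
      omega
    obtain ⟨B, rfl⟩ := Multiset.exists_cons_of_mem hl
    rw [Multiset.count_cons_of_ne hl0.symm] at h0
    exact ⟨0, l, B, rfl, hl0, by omega⟩
  · obtain ⟨k, A, rfl, hA'⟩ := Multiset.card_eq_succ_iff.1 hA
    obtain ⟨l, B, rfl, -⟩ := Multiset.card_eq_succ_iff.1 hA'
    simp only [Multiset.mem_cons, not_or] at h
    refine ⟨k, l, B, rfl, Ne.symm h.2.1, ?_⟩
    rw [Multiset.count_eq_zero_of_notMem h.2.2]
    exact Nat.zero_le m

theorem mem_weightSet_iff (m : ℕ) (T : Multiset (Fin 2)) (A : Multiset (Fin 4)) :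
    (T, A) ∈ weightSet varWt m ↔
      A.card = 2 * m ∧ A.count 0 ≤ m ∧ T.card + A.count 0 = m + A.count 3 := by
  constructor
  · have key : ∀ s : Multiset Lam, (s.map varWt).sum.2.card = 2 * s.card ∧
        (s.map varWt).sum.2.count 0 ≤ s.card ∧ (s.map varWt).sum.1.card +
          (s.map varWt).sum.2.count 0 = s.card + (s.map varWt).sum.2.count 3 := by
      intro s
      induction s using Multiset.induction with
      | empty => simp
      | cons v s ih =>
        have := varWt_mem v
        simp only [Multiset.map_cons, Multiset.sum_cons, Prod.fst_add, Prod.snd_add,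
          Multiset.card_add, Multiset.count_add, Multiset.card_cons]
        omega
    rintro ⟨s, rfl, h⟩
    have := key s
    rwa [h] at this
  · rintro ⟨hA, h0, hT⟩
    induction m generalizing T A with
    | zero =>
      obtain rfl := Multiset.card_eq_zero.1 hA
      obtain rfl := Multiset.card_eq_zero.1 (by simpa using hT)
      exact ⟨0, rfl, rfl⟩
    | succ m ih =>
      obtain ⟨k, l, B, rfl, hl, hB⟩ := exists_pair hA h0
      have key : ∀ k l : Fin 4, l ≠ 0 → 0 < av k + av l ∧
          av k + av l + ({k, l} : Multiset (Fin 4)).count 0 =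
            2 + ({k, l} : Multiset (Fin 4)).count 3 := by decide
      obtain ⟨hpos, hkl⟩ := key k l hl
      have hsplit : k ::ₘ l ::ₘ B = {k, l} + B := by simp
      rw [hsplit] at hA hT ⊢
      simp only [Multiset.card_add, Multiset.count_add, Multiset.card_pair] at hA hT
      obtain ⟨D, hD⟩ : ∃ D, D ∈ T.powersetCard (av k + av l - 1) := by
        rw [← Multiset.card_pos_iff_exists_mem, Multiset.card_powersetCard]
        exact Nat.choose_pos (by omega)
      obtain ⟨hD, hDcard⟩ := Multiset.mem_powersetCard.1 hD
      obtain ⟨T', rfl⟩ := Multiset.le_iff_exists_add.1 hD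
      rw [Multiset.card_add] at hT
      obtain ⟨v, hv⟩ := exists_varWt_eq k l D (by omega)
      obtain ⟨s, hs, hsum⟩ := ih T' B (by omega) hB (by omega)
      exact ⟨v ::ₘ s, by simp [hs], by simp [hv, hsum]⟩

/-- Exponents `(α₁, α₄, α₂, i)` of the degree-`m` monomials
`t₁^i t₂^j x₁^α₁ x₂^α₂ x₃^α₃ x₄^α₄`. -/
def exponents (m : ℕ) : Finset (Σ _ : ℕ, Σ _ : ℕ, ℕ × ℕ) :=
  (Finset.range (m + 1)).sigma fun a => (Finset.range (2 * m - a + 1)).sigma fun b =>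
    Finset.range (2 * m - a - b + 1) ×ˢ Finset.range (m + b - a + 1)

theorem ncard_weightSet_eq_card (m : ℕ) : (weightSet varWt m).ncard = (exponents m).card := by
  have hcard : ∀ A : Multiset (Fin 4),
      A.card = A.count 0 + A.count 1 + A.count 2 + A.count 3 := by
    intro A
    rw [← Fin.sum_univ_four fun i => A.count i,
      Multiset.sum_count_eq_card (fun a _ => Finset.mem_univ a)]
  have hcard' : ∀ T : Multiset (Fin 2), T.card = T.count 0 + T.count 1 := by
    intro T
    rw [← Fin.sum_univ_two fun i => T.count i,
      Multiset.sum_count_eq_card (fun a _ => Finset.mem_univ a)]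
  rw [← Set.ncard_coe_finset]
  refine Set.ncard_congr (fun p _ => ⟨p.2.count 0, p.2.count 3, p.2.count 1, p.1.count 0⟩) ?_ ?_ ?_
  · rintro ⟨T, A⟩ h
    rw [mem_weightSet_iff, hcard, hcard'] at h
    simp only [exponents, Finset.mem_coe, Finset.mem_sigma, Finset.mem_product, Finset.mem_range]
    omega
  · rintro ⟨T, A⟩ ⟨T', A'⟩ h h' e
    rw [mem_weightSet_iff, hcard, hcard'] at h h'
    simp only [Sigma.mk.injEq, heq_eq_eq, Prod.mk.injEq] at e
    refine Prod.ext (Multiset.ext.2 fun i => ?_) (Multiset.ext.2 fun i => ?_)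
    · fin_cases i <;> simp <;> omega
    · fin_cases i <;> simp <;> omega
  · rintro ⟨a, b, c, i⟩ h
    simp only [exponents, Finset.mem_coe, Finset.mem_sigma, Finset.mem_product,
      Finset.mem_range] at h
    refine ⟨(Multiset.replicate i 0 + Multiset.replicate (m + b - a - i) 1,
      Multiset.replicate a 0 + Multiset.replicate c 1 +
        Multiset.replicate (2 * m - a - b - c) 2 + Multiset.replicate b 3), ?_, ?_⟩
    · rw [mem_weightSet_iff]
      simp [Multiset.count_replicate]
      omega
    · simp [Multiset.count_replicate]

theorem six_mul_choose_three (n : ℕ) :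
    (6 : ℚ) * (n + 3).choose 3 = (n + 1) * (n + 2) * (n + 3) := by
  have h := Nat.descFactorial_eq_factorial_mul_choose (n + 3) 3
  rw [show Nat.factorial 3 = 6 from rfl] at h
  simp only [Nat.descFactorial] at h
  rw [show n + 3 - 2 = n + 1 by omega, show n + 3 - 1 = n + 2 by omega] at h
  have h' : ((n : ℚ) + 1) * ((n + 2) * (n + 3)) = 6 * (n + 3).choose 3 := by
    exact_mod_cast (by simpa using h)
  linear_combination -h'

theorem sum_range_linear_mul_linear (k : ℕ) (N c : ℚ) :
    ∑ b ∈ Finset.range k, (N - b + 1) * (c + b) =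
      k * (N + 1) * c + (N + 1 - c) * (k * (k - 1)) / 2 - k * (k - 1) * (2 * k - 1) / 6 := by
  induction k with
  | zero => simp
  | succ k ih =>
    rw [Finset.sum_range_succ, ih]
    push_cast
    ring

theorem sum_range_cubic (k : ℕ) (M : ℚ) :
    ∑ a ∈ Finset.range k, (2 * M - a + 1) * (2 * M - a + 2) * (5 * M - 4 * a + 3) / 6 =
      (2 * M + 1) * (2 * M + 2) * (2 * M + 3) * (M + 1) / 6 -
        (2 * M - k + 1) * (2 * M - k + 2) * (2 * M - k + 3) * (M - k + 1) / 6 := by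
  induction k with
  | zero => simp
  | succ k ih =>
    rw [Finset.sum_range_succ, ih]
    push_cast
    ring

theorem card_exponents (m : ℕ) : (exponents m).card = (m + 1) * (2 * m + 3).choose 3 := by
  have inner : ∀ a ∈ Finset.range (m + 1), ∑ b ∈ Finset.range (2 * m - a + 1),
      (((2 * m - a - b + 1) * (m + b - a + 1) : ℕ) : ℚ) =
        (2 * m - a + 1) * (2 * m - a + 2) * (5 * m - 4 * a + 3) / 6 := by
    intro a ha
    have ha : a ≤ m := by simpa [Nat.lt_succ_iff] using ha
    have hN : ((2 * m - a : ℕ) : ℚ) = 2 * m - a := by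
      rw [Nat.cast_sub (by omega)]
      push_cast
      ring
    have h := sum_range_linear_mul_linear (2 * m - a + 1) (2 * m - a) (m - a + 1)
    push_cast at h
    rw [hN] at h
    refine (Finset.sum_congr rfl fun b hb => ?_).trans (h.trans (by ring))
    rw [Finset.mem_range] at hb
    rw [Nat.cast_mul, Nat.cast_add, Nat.cast_sub (by omega), hN, Nat.cast_add,
      Nat.cast_sub (by omega)]
    push_cast
    ring
  have h6 := six_mul_choose_three (2 * m)
  have hsum := sum_range_cubic (m + 1) m
  rw [← Finset.sum_congr rfl inner] at hsum
  rw [← Nat.cast_inj (R := ℚ)]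
  simp only [exponents, Finset.card_sigma, Finset.card_product, Finset.card_range]
  push_cast at h6 hsum ⊢
  rw [hsum]
  linear_combination (-(m + 1 : ℚ) / 6) * h6

theorem ncard_weightSet (m : ℕ) :
    (weightSet varWt m).ncard = (m + 1) * (2 * m + 3).choose 3 :=
  (ncard_weightSet_eq_card m).trans (card_exponents m)

end Scroll

/-- For all sufficiently large `m`, the degree-`m` graded pieces of
`R₀/(∧²M₀)` and `R₁/(∧²M₁)` have the same dimension as ℂ-vector spaces: the two quotient
rings have the same Hilbert polynomial.  (Geometrically: the Hilbert polynomials of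
`Q ⊂ ℙ¹⁹` and of the Segre–Veronese image of `ℙ¹ × ℙ³` in `ℙ¹⁹` agree.) -/
theorem hilbert_polynomials_agree :
    ∃ m₀ : ℕ, ∀ m ≥ m₀,
      Module.finrank ℂ
        (Submodule.map (Ideal.Quotient.mkₐ ℂ (minors2 M0)).toLinearMap
          (MvPolynomial.homogeneousSubmodule Lam ℂ m)) =
      Module.finrank ℂ
        (Submodule.map (Ideal.Quotient.mkₐ ℂ (minors2 M1)).toLinearMap
          (MvPolynomial.homogeneousSubmodule ZVar ℂ m)) := by
  refine ⟨0, fun m _ => ?_⟩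
  rw [Scroll.finrank_eq, SegreVeronese.finrank_eq, Scroll.ncard_weightSet,
    SegreVeronese.ncard_weightSet]
end

section
/- Consider the monomials t₁^i t₂^j x₁^{q₁} x₂^{q₂} x₃^{q₃} x₄^{q₄} with non-negative exponents satisfying q₁ + q₂ + q₃ + q₄ = 2 and i + j + 1 = q₂ + q₃ + 2q₄ (call these half-anticanonical monomials), and the monomials with q₁ + q₂ + q₃ + q₄ = 4 and i + j + 2 = q₂ + q₃ + 2q₄ (call these anticanonical monomials). Then an anticanonical monomial is a product of two half-anticanonical monomials if and only if it is not equal to x₁³x₄; in particular x₁³x₄ is an anticanonical monomial that is not such a product, and it is the unique one. -/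
/-- Exponent vectors `(i, j, q)` of monomials `t₁^i t₂^j x₁^{q₁} x₂^{q₂} x₃^{q₃} x₄^{q₄}`
in the Cox ring of `𝔽(0,1,1,2)`; a product of monomials corresponds to the sum of their
exponent vectors. -/
abbrev ExpVec : Type := ℕ × ℕ × (Fin 4 → ℕ)

/-- The half-anticanonical monomials of `𝔽(0,1,1,2)`:
`q₁ + q₂ + q₃ + q₄ = 2` and `i + j + 1 = q₂ + q₃ + 2q₄`. -/
def HalfAC : Set ExpVec :=
  {w | w.2.2 0 + w.2.2 1 + w.2.2 2 + w.2.2 3 = 2 ∧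
    w.1 + w.2.1 + 1 = w.2.2 1 + w.2.2 2 + 2 * w.2.2 3}

/-- The anticanonical monomials of `𝔽(0,1,1,2)`:
`q₁ + q₂ + q₃ + q₄ = 4` and `i + j + 2 = q₂ + q₃ + 2q₄`. -/
def AC : Set ExpVec :=
  {w | w.2.2 0 + w.2.2 1 + w.2.2 2 + w.2.2 3 = 4 ∧
    w.1 + w.2.1 + 2 = w.2.2 1 + w.2.2 2 + 2 * w.2.2 3}

/-- A monomial of degree `4` in the `x_k` that is divisible by `x₁` at most twice is a product of
two monomials of degree `2`, each divisible by `x₁` at most once. -/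
theorem exists_balanced_split {a b c d : ℕ} (h : a + b + c + d = 4) (ha : a ≤ 2) :
    ∃ a' ≤ a, ∃ b' ≤ b, ∃ c' ≤ c, ∃ d' ≤ d,
      a' + b' + c' + d' = 2 ∧ a' ≤ 1 ∧ a - a' ≤ 1 :=
  ⟨a / 2, by omega, min b (2 - a / 2), by omega, min c (2 - a / 2 - min b (2 - a / 2)), by omega,
    2 - a / 2 - min b (2 - a / 2) - min c (2 - a / 2 - min b (2 - a / 2)), by omega,
    by omega, by omega, by omega⟩

/-- If two positive weights `m`, `n` satisfy `i + j + 2 = m + n`, then `t₁^i t₂^j` is a product of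
two monomials in `t₁`, `t₂` of degrees `m - 1` and `n - 1`. -/
theorem exists_split_of_add_eq {i j m n : ℕ} (h : i + j + 2 = m + n) (hm : 1 ≤ m) (hn : 1 ≤ n) :
    ∃ i' ≤ i, ∃ j' ≤ j, i' + j' + 1 = m ∧ (i - i') + (j - j') + 1 = n :=
  ⟨min i (m - 1), by omega, m - 1 - min i (m - 1), by omega, by omega, by omega⟩

theorem exists_halfAC_add {w : ExpVec} (hw : w ∈ AC) (h0 : w.2.2 0 ≤ 2) :
    ∃ u ∈ HalfAC, ∃ v ∈ HalfAC, w = u + v := by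
  obtain ⟨i, j, q⟩ := w
  obtain ⟨hq, hij⟩ := hw
  dsimp only at hq hij h0
  obtain ⟨a, ha, b, hb, c, hc, d, hd, hsum, ha₁, ha₂⟩ := exists_balanced_split hq h0
  obtain ⟨i', hi, j', hj, hm, hn⟩ := exists_split_of_add_eq
    (m := b + c + 2 * d) (n := (q 1 - b) + (q 2 - c) + 2 * (q 3 - d))
    (i := i) (j := j) (by omega) (by omega) (by omega)
  refine ⟨(i', j', ![a, b, c, d]), ⟨hsum, hm⟩,
    (i - i', j - j', ![q 0 - a, q 1 - b, q 2 - c, q 3 - d]), ⟨?_, hn⟩, ?_⟩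
  · change (q 0 - a) + (q 1 - b) + (q 2 - c) + (q 3 - d) = 2
    omega
  · refine Prod.ext (by simp [hi]) (Prod.ext (by simp [hj]) (funext fun k => ?_))
    fin_cases k <;> simp [ha, hb, hc, hd]

theorem eq_of_mem_AC_of_two_lt {w : ExpVec} (hw : w ∈ AC) (h0 : 2 < w.2.2 0) :
    w = (0, 0, ![3, 0, 0, 1]) := by
  obtain ⟨i, j, q⟩ := w
  obtain ⟨hq, hij⟩ := hw
  dsimp only at hq hij h0
  refine Prod.ext (by dsimp only; omega) (Prod.ext (by dsimp only; omega) (funext fun k => ?_))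
  fin_cases k <;> simp <;> omega

theorem halfAC_add_ne {u v : ExpVec} (hu : u ∈ HalfAC) (hv : v ∈ HalfAC) :
    u + v ≠ (0, 0, ![3, 0, 0, 1]) := by
  intro h
  have hk (k : Fin 4) : u.2.2 k + v.2.2 k = (![3, 0, 0, 1] : Fin 4 → ℕ) k :=
    congrFun (congrArg (fun w : ExpVec => w.2.2) h) k
  have h1 : u.2.2 1 + v.2.2 1 = 0 := hk 1
  have h2 : u.2.2 2 + v.2.2 2 = 0 := hk 2
  have h3 : u.2.2 3 + v.2.2 3 = 1 := hk 3
  have hu' := hu.2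
  have hv' := hv.2
  omega

/-- An anticanonical monomial of `𝔽(0,1,1,2)` is a product of two
half-anticanonical monomials if and only if it is not `x₁³x₄`; in particular `x₁³x₄` is an
anticanonical monomial that is not such a product, and it is the unique one. -/
theorem anticanonical_product_characterisation :
    ((0, 0, ![3, 0, 0, 1]) : ExpVec) ∈ AC ∧
    ∀ w ∈ AC, (∃ u ∈ HalfAC, ∃ v ∈ HalfAC, w = u + v) ↔
      w ≠ ((0, 0, ![3, 0, 0, 1]) : ExpVec) := by
  refine ⟨⟨rfl, rfl⟩, fun w hw => ⟨?_, fun hne => ?_⟩⟩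
  · rintro ⟨u, hu, v, hv, rfl⟩
    exact halfAC_add_ne hu hv
  · exact exists_halfAC_add hw (not_lt.mp fun h0 => hne (eq_of_mem_AC_of_two_lt hw h0))
end

section
/- For the action of (ℂˣ)² on ℂ² × ℂⁿ given by (λ,μ)·(t₁,t₂; x₁,…,xₙ) = (λt₁, λt₂; λ^{−a₁}μ^{b₁}x₁, …, λ^{−aₙ}μ^{bₙ}xₙ), the orbit of every point u ∈ U = (ℂ²∖{0}) × (ℂⁿ∖{0}) is a closed subset of U in the subspace topology induced from the standard topology on ℂ^{2+n}. -/
open Filter Topology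

/-- If a positive power of `f` converges along an ultrafilter, then so does `f` itself. -/
theorem Ultrafilter.exists_tendsto_of_tendsto_pow {X 𝕜 : Type*} [NormedField 𝕜] [ProperSpace 𝕜]
    (u : Ultrafilter X) {f : X → 𝕜} {k : ℕ} (hk : 0 < k) {c : 𝕜}
    (h : Tendsto (fun x => f x ^ k) u (𝓝 c)) : ∃ m, Tendsto f u (𝓝 m) := by
  have hbound : ∀ᶠ x in (u : Filter X), f x ∈ Metric.closedBall (0 : 𝕜) (‖c‖ + 1) := by
    filter_upwards [h.norm.eventually (gt_mem_nhds (lt_add_one ‖c‖))] with x hx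
    rw [mem_closedBall_zero_iff]
    by_contra! hlt
    have h1 : 1 ≤ ‖f x‖ := by linarith [norm_nonneg c]
    have h2 := le_self_pow₀ h1 hk.ne'
    rw [norm_pow] at hx
    linarith
  obtain ⟨m, -, hm⟩ := (isCompact_closedBall (0 : 𝕜) (‖c‖ + 1)).ultrafilter_le_nhds
    (u.map f) (le_principal_iff.2 hbound)
  exact ⟨m, hm⟩

/-- The action of `(ℂˣ)²` on `ℂ² × ℂⁿ` defining the weighted scroll
`𝔽(a₁,…,aₙ | b₁,…,bₙ)`:
`(λ,μ)·(t₁,t₂; x₁,…,xₙ) = (λt₁, λt₂; λ^{−a₁}μ^{b₁}x₁, …, λ^{−aₙ}μ^{bₙ}xₙ)`. -/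
def scrollAct {n : ℕ} (a : Fin n → ℤ) (b : Fin n → ℕ) (g : ℂˣ × ℂˣ)
    (p : (Fin 2 → ℂ) × (Fin n → ℂ)) : (Fin 2 → ℂ) × (Fin n → ℂ) :=
  (fun i => (g.1 : ℂ) * p.1 i, fun j => ((g.1 ^ (-a j) * g.2 ^ (b j) : ℂˣ) : ℂ) * p.2 j)

/-- The open subset `U = (ℂ²∖{0}) × (ℂⁿ∖{0})` of `ℂ² × ℂⁿ`. -/
def scrollU (n : ℕ) : Set ((Fin 2 → ℂ) × (Fin n → ℂ)) :=
  {p | p.1 ≠ 0 ∧ p.2 ≠ 0}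

/-- For the `(ℂˣ)²`-action defining the weighted scroll, the orbit of
every point `p ∈ U = (ℂ²∖{0}) × (ℂⁿ∖{0})` is a closed subset of `U` in the subspace
topology induced from the standard topology on `ℂ^{2+n}`.  This is the key point in
showing that `U → 𝔽(a₁,…,aₙ | b₁,…,bₙ)` is a geometric quotient. -/
theorem scrollAct_orbits_closed (n : ℕ) (hn : 1 < n) (a : Fin n → ℤ) (b : Fin n → ℕ)
    (hb : ∀ j, 0 < b j) :
    ∀ p ∈ scrollU n,
      IsClosed {q : scrollU n | ∃ g : ℂˣ × ℂˣ, scrollAct a b g p = (q : _)} := by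
  rintro p ⟨hp₁, hp₂⟩
  obtain ⟨i₀, hi₀⟩ := Function.ne_iff.1 hp₁
  obtain ⟨j₀, hj₀⟩ := Function.ne_iff.1 hp₂
  simp only [Pi.zero_apply] at hi₀ hj₀
  rw [isClosed_iff_ultrafilter]
  intro q u huq hu
  obtain ⟨g, hg⟩ : ∃ g : scrollU n → ℂˣ × ℂˣ,
      ∀ᶠ r in (u : Filter (scrollU n)), scrollAct a b (g r) p = (r : _) := by
    choose! g hg using fun r : scrollU n => fun h : ∃ g : ℂˣ × ℂˣ, scrollAct a b g p = (r : _) => h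
    exact ⟨g, Filter.mem_of_superset hu hg⟩
  have hcoe : Tendsto (fun r : scrollU n => (r : (Fin 2 → ℂ) × (Fin n → ℂ))) u (𝓝 q) :=
    (continuous_subtype_val.tendsto q).mono_left huq
  have ht (i : Fin 2) : Tendsto (fun r => ((g r).1 : ℂ) * p.1 i) u (𝓝 (q.1.1 i)) := by
    refine (((continuous_apply i).comp continuous_fst).continuousAt.tendsto.comp hcoe).congr' ?_
    filter_upwards [hg] with r hr
    simp [← hr, scrollAct]
  have hx (j : Fin n) : Tendsto (fun r => ((g r).1 : ℂ) ^ (-a j) * ((g r).2 : ℂ) ^ b j * p.2 j) u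
      (𝓝 (q.1.2 j)) := by
    refine (((continuous_apply j).comp continuous_snd).continuousAt.tendsto.comp hcoe).congr' ?_
    filter_upwards [hg] with r hr
    simp [← hr, scrollAct]
  obtain ⟨l, hl⟩ : ∃ l, Tendsto (fun r => ((g r).1 : ℂ)) u (𝓝 l) :=
    ⟨_, ((ht i₀).div_const (p.1 i₀)).congr fun r => mul_div_cancel_right₀ _ hi₀⟩
  have hq₁ (i : Fin 2) : l * p.1 i = q.1.1 i := tendsto_nhds_unique (hl.mul_const _) (ht i)
  have hl0 : l ≠ 0 := by
    rintro rfl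
    exact q.2.1 (funext fun i => by simp [← hq₁ i])
  obtain ⟨m, hm⟩ : ∃ m, Tendsto (fun r => ((g r).2 : ℂ)) u (𝓝 m) := by
    refine u.exists_tendsto_of_tendsto_pow (hb j₀)
      ((((hx j₀).div_const (p.2 j₀)).mul (hl.zpow₀ (a j₀) (Or.inl hl0))).congr fun r => ?_)
    have h0 : ((g r).1 : ℂ) ^ a j₀ ≠ 0 := zpow_ne_zero _ (g r).1.ne_zero
    rw [zpow_neg]
    field_simp
  have hq₂ (j : Fin n) : l ^ (-a j) * m ^ b j * p.2 j = q.1.2 j :=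
    tendsto_nhds_unique (((hl.zpow₀ (-a j) (Or.inl hl0)).mul (hm.pow (b j))).mul_const _) (hx j)
  have hm0 : m ≠ 0 := by
    rintro rfl
    exact q.2.2 (funext fun j => by simp [← hq₂ j, (hb j).ne'])
  refine ⟨(Units.mk0 l hl0, Units.mk0 m hm0), Prod.ext (funext fun i => ?_) (funext fun j => ?_)⟩
  · simpa [scrollAct] using hq₁ i
  · simpa [scrollAct] using hq₂ j
end
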